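/- arXiv:1604.07350 — 2 statements merged into one kernel-verified Lean document; each statement's English description precedes it below -/
import Mathlib

section
/- Let μ be a probability measure on ℝ with characteristic function φ. Then μ is stable if and only if there exist real numbers α, c, β, m with 0 < α ≤ 2, c ≥ 0 and |β| ≤ 1 such that φ(t) = exp(ψ_{α,c,β,m}(t)) for all real t, where ψ_{α,c,β,m}(t) = i m t − |c t|^α (1 − i β sign(t) ω_α(t)), with ω_α(t) = tan(πα/2) if α ≠ 1 and ω_1(t) = −(2/π) log|t|. -/
open MeasureTheory Complex Filter

/-- The characteristic function of a measure on ℝ. -/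
noncomputable def charFun' (μ : Measure ℝ) (t : ℝ) : ℂ :=
  ∫ x, Complex.exp (Complex.I * t * x) ∂μ

/-- A measure `μ` is stable if for each positive integer `n` there are constants
`a > 0` and `b` with `φ(t)^n = φ(a t) exp(i b t)` for all `t`. -/
def IsStable (μ : Measure ℝ) : Prop :=
  ∀ n : ℕ, 0 < n → ∃ a b : ℝ, 0 < a ∧
    ∀ t : ℝ, (charFun' μ t) ^ n = charFun' μ (a * t) * Complex.exp (Complex.I * b * t)

/-- The logarithm `ψ_{α,c,β,m}(t)` of the stable characteristic function. -/
noncomputable def stablePsi (α c β m : ℝ) (t : ℝ) : ℂ :=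
  Complex.I * m * t - ((|c * t| ^ α : ℝ) : ℂ) *
    (1 - Complex.I * β * Real.sign t *
      ((if α = 1 then -(2 / Real.pi) * Real.log |t| else Real.tan (Real.pi * α / 2) : ℝ) : ℂ))

/-- `h` is multiplied by `r` when its argument is dilated by `ρ`. -/
def ScalesBy (h : ℝ → ℝ) (r ρ : ℝ) : Prop := ∀ t, r * h t = h (ρ * t)

namespace ScalesBy

variable {h : ℝ → ℝ} {r ρ r' ρ' : ℝ}

theorem mul (H : ScalesBy h r ρ) (H' : ScalesBy h r' ρ') :
    ScalesBy h (r * r') (ρ * ρ') := fun t => by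
  rw [mul_assoc, H', H, mul_assoc]

theorem inv (H : ScalesBy h r ρ) (hr : r ≠ 0) (hρ : ρ ≠ 0) :
    ScalesBy h r⁻¹ ρ⁻¹ := fun t => by
  have := H (ρ⁻¹ * t)
  rw [mul_inv_cancel_left₀ hρ] at this
  rw [← this, inv_mul_cancel_left₀ hr]

theorem pow (H : ScalesBy h r ρ) (n : ℕ) : ScalesBy h (r ^ n) (ρ ^ n) := by
  induction n with
  | zero => intro t; simp
  | succ n ih => simpa only [pow_succ] using ih.mul H

theorem zpow (H : ScalesBy h r ρ) (hr : r ≠ 0) (hρ : ρ ≠ 0) (n : ℤ) :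
    ScalesBy h (r ^ n) (ρ ^ n) := by
  cases n with
  | ofNat n => simpa using H.pow n
  | negSucc n =>
    simpa only [zpow_negSucc] using (H.pow (n + 1)).inv (pow_ne_zero _ hr) (pow_ne_zero _ hρ)

theorem lt_one (H : ScalesBy h r ρ) (hc : Continuous h) {t₁ : ℝ} (h₁ : h t₁ ≠ 0)
    (hr0 : 0 < r) (hr : r < 1) : ρ < 1 ∨ ρ ≤ 0 := by
  by_contra! hcon
  obtain ⟨hρ, hρ0⟩ := hcon
  obtain ⟨x, hx, hmax⟩ := (isCompact_Icc (a := -|t₁|) (b := |t₁|)).exists_isMaxOn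
    ⟨t₁, neg_abs_le _, le_abs_self _⟩ (f := fun t => |h t|) (by fun_prop)
  have hx' : x / ρ ∈ Set.Icc (-|t₁|) (|t₁|) := by
    rw [Set.mem_Icc, ← abs_le] at hx ⊢
    rw [abs_div, abs_of_pos hρ0]
    exact (div_le_self (abs_nonneg _) hρ).trans hx
  have h2 := H (x / ρ)
  rw [mul_div_cancel₀ _ hρ0.ne'] at h2
  have h3 : |h (x / ρ)| ≤ |h x| := hmax hx'
  have h4 : |h t₁| ≤ |h x| := hmax ⟨neg_abs_le _, le_abs_self _⟩
  have h5 : |h x| = r * |h (x / ρ)| := by rw [← h2, abs_mul, abs_of_pos hr0]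
  have h6 : 0 < |h t₁| := abs_pos.2 h₁
  nlinarith

theorem log_neg (H : ScalesBy h r ρ) (hc : Continuous h) {t₁ : ℝ} (h₁ : h t₁ ≠ 0)
    (hr0 : 0 < r) (hρ0 : 0 < ρ) (hr : Real.log r < 0) : Real.log ρ < 0 := by
  have hr1 : r < 1 := by
    by_contra! hcon
    exact absurd (Real.log_nonneg hcon) (not_le.2 hr)
  exact Real.log_neg hρ0 ((H.lt_one hc h₁ hr0 hr1).resolve_right (not_le.2 hρ0))

theorem log_eq_mul (H : ScalesBy h r ρ) (H' : ScalesBy h r' ρ') (hc : Continuous h) {t₁ : ℝ}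
    (h₁ : h t₁ ≠ 0) (hr0 : 0 < r) (hρ0 : 0 < ρ) (hr0' : 0 < r') (hρ0' : 0 < ρ')
    (hr : 0 < Real.log r) (hρ : 0 < Real.log ρ) :
    Real.log ρ' = Real.log ρ / Real.log r * Real.log r' := by
  have key : ∀ p q : ℤ, p * Real.log r + q * Real.log r' < 0 →
      p * Real.log ρ + q * Real.log ρ' < 0 := by
    intro p q hpq
    have G := (H.zpow hr0.ne' hρ0.ne' p).mul (H'.zpow hr0'.ne' hρ0'.ne' q)
    have e : ∀ x y : ℝ, 0 < x → 0 < y →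
        Real.log (x ^ p * y ^ q) = p * Real.log x + q * Real.log y := fun x y hx hy => by
      rw [Real.log_mul (zpow_pos hx p).ne' (zpow_pos hy q).ne', Real.log_zpow, Real.log_zpow]
    rw [← e _ _ hρ0 hρ0']
    exact G.log_neg hc h₁ (mul_pos (zpow_pos hr0 p) (zpow_pos hr0' q))
      (mul_pos (zpow_pos hρ0 p) (zpow_pos hρ0' q)) (by rwa [e _ _ hr0 hr0'])
  have hxy : Real.log ρ' / Real.log ρ = Real.log r' / Real.log r := by
    refine le_antisymm ?_ ?_ <;> by_contra! hcon
    · obtain ⟨s, hs1, hs2⟩ := exists_rat_btwn hcon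
      have hden : (0 : ℝ) < s.den := by exact_mod_cast s.pos
      rw [Rat.cast_def] at hs1 hs2
      rw [div_lt_div_iff₀ hr hden] at hs1
      rw [div_lt_div_iff₀ hden hρ] at hs2
      have := key (-s.num) s.den (by push_cast; linarith)
      push_cast at this
      linarith
    · obtain ⟨s, hs1, hs2⟩ := exists_rat_btwn hcon
      have hden : (0 : ℝ) < s.den := by exact_mod_cast s.pos
      rw [Rat.cast_def] at hs1 hs2
      rw [div_lt_div_iff₀ hρ hden] at hs1
      rw [div_lt_div_iff₀ hden hr] at hs2
      have := key s.num (-s.den) (by push_cast; linarith)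
      push_cast at this
      linarith
  field_simp at hxy ⊢
  linarith

end ScalesBy

/-- The dilation factors belonging to a nonzero continuous function are powers of the index. -/
theorem exists_rpow_of_scalesBy {h : ℝ → ℝ} (hc : Continuous h) {t₁ : ℝ} (h₁ : h t₁ ≠ 0)
    {a : ℕ → ℝ} (ha : ∀ n, 0 < n → 0 < a n) (H : ∀ n : ℕ, 0 < n → ScalesBy h n (a n)) :
    ∃ α : ℝ, 0 < α ∧ ∀ n : ℕ, 0 < n → a n = (n : ℝ) ^ α⁻¹ := by
  have h2 : 0 < Real.log (a 2) := by
    have := ((H 2 two_pos).inv (by norm_num) (ha 2 two_pos).ne').log_neg hc h₁ (by norm_num)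
      (inv_pos.2 (ha 2 two_pos))
      (by rw [Real.log_inv]; simpa using Real.log_pos one_lt_two)
    rw [Real.log_inv] at this
    linarith
  have hl2 : 0 < Real.log 2 := Real.log_pos one_lt_two
  refine ⟨(Real.log (a 2) / Real.log 2)⁻¹, by positivity, fun n hn => ?_⟩
  have hn' : (0 : ℝ) < n := by exact_mod_cast hn
  have := (H 2 two_pos).log_eq_mul (H n hn) hc h₁ (by norm_num) (ha 2 two_pos) hn' (ha n hn)
    (by simpa using hl2) h2
  rw [inv_inv, Real.rpow_def_of_pos hn', ← Real.exp_log (ha n hn), this]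
  congr 1
  push_cast
  ring

/-- A function on the positive half line determined by its values at positive rationals. -/
theorem eq_of_eq_on_pos_rat {f g : ℝ → ℂ} (hf : ContinuousOn f (Set.Ioi 0))
    (hg : ContinuousOn g (Set.Ioi 0))
    (H : ∀ p q : ℕ, 0 < p → 0 < q → f ((p : ℝ) / q) = g ((p : ℝ) / q)) {s : ℝ} (hs : 0 < s) :
    f s = g s := by
  have hsub : Set.Ioi (0 : ℝ) ⊆ closure (Set.Ioi 0 ∩ Set.range ((↑) : ℚ → ℝ)) :=
    Rat.isDenseEmbedding_coe_real.dense.open_subset_closure_inter isOpen_Ioi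
  have heq : Set.EqOn f g (Set.Ioi 0 ∩ Set.range ((↑) : ℚ → ℝ)) := by
    rintro _ ⟨hx, x, rfl⟩
    have hx0 : 0 < x := Rat.cast_pos.1 (Set.mem_Ioi.1 hx)
    have := H x.num.toNat x.den (by simpa using Rat.num_pos.2 hx0) x.pos
    have e : ((x.num.toNat : ℕ) : ℝ) = (x.num : ℝ) := by
      exact_mod_cast Int.toNat_of_nonneg (Rat.num_pos.2 hx0).le
    rwa [e, ← Rat.cast_def] at this
  exact heq.of_subset_closure hf hg Set.inter_subset_left hsub hs

/-- Continuous functions homogeneous under dilations by `n ^ α⁻¹` are power functions. -/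
theorem eq_rpow_of_homogeneous {χ : ℝ → ℂ} (hc : ContinuousOn χ (Set.Ioi 0)) {α : ℝ} (hα : 0 < α)
    (H : ∀ n : ℕ, 0 < n → ∀ t, 0 < t → n * χ t = χ ((n : ℝ) ^ α⁻¹ * t)) {t : ℝ} (ht : 0 < t) :
    χ t = χ 1 * ((t ^ α : ℝ) : ℂ) := by
  have key : ∀ s : ℝ, 0 < s → χ (s ^ α⁻¹) = s * χ 1 := by
    intro s hs
    refine eq_of_eq_on_pos_rat (f := fun s => χ (s ^ α⁻¹)) (g := fun s => s * χ 1)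
      ?_ (by fun_prop) ?_ hs
    · refine hc.comp (fun x hx => ?_) (fun x hx => Real.rpow_pos_of_pos hx _)
      exact (Real.continuousAt_rpow_const _ _ (Or.inl (ne_of_gt hx))).continuousWithinAt
    · intro p q hp hq
      have hp' : (0 : ℝ) < p := by exact_mod_cast hp
      have hq' : (0 : ℝ) < q := by exact_mod_cast hq
      have h1 := H p hp (((q : ℝ) ^ α⁻¹)⁻¹) (by positivity)
      have h2 := H q hq (((q : ℝ) ^ α⁻¹)⁻¹) (by positivity)
      rw [mul_inv_cancel₀ (by positivity)] at h2
      rw [← div_eq_mul_inv, ← Real.div_rpow hp'.le hq'.le] at h1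
      have hqc : (q : ℂ) ≠ 0 := by exact_mod_cast hq.ne'
      rw [← h1, ← h2]
      push_cast
      field_simp
  have := key (t ^ α) (Real.rpow_pos_of_pos ht _)
  rw [Real.rpow_rpow_inv ht.le hα.ne'] at this
  rw [this, mul_comm]

/-- A continuous function whose increments under dilations by integers are constant is an affine
function of the logarithm. -/
theorem exists_eq_add_mul_log {u : ℝ → ℂ} (hc : ContinuousOn u (Set.Ioi 0)) {d : ℕ → ℂ}
    (H : ∀ n : ℕ, 0 < n → ∀ t, 0 < t → u (n * t) = u t + d n) :
    ∃ D : ℂ, ∀ t, 0 < t → u t = u 1 + D * Real.log t := by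
  have key : ∀ s t : ℝ, 0 < s → 0 < t → u (s * t) = u s + u t - u 1 := by
    intro s t hs ht
    refine eq_of_eq_on_pos_rat (f := fun s => u (s * t)) (g := fun s => u s + u t - u 1)
      ?_ (by fun_prop) ?_ hs
    · exact hc.comp (by fun_prop) (fun x hx => mul_pos hx ht)
    · intro p q hp hq
      have hp' : (0 : ℝ) < p := by exact_mod_cast hp
      have hq' : (0 : ℝ) < q := by exact_mod_cast hq
      have h1 := H p hp (t / q) (by positivity)
      have h2 := H q hq (t / q) (by positivity)
      have h3 := H p hp (1 / q) (by positivity)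
      have h4 := H q hq (1 / q) (by positivity)
      rw [mul_div_cancel₀ _ hq'.ne'] at h2 h4
      rw [mul_one_div] at h3
      rw [div_mul_eq_mul_div, ← mul_div_assoc']
      rw [h1, h3, h2, h4]
      ring
  let U : ℝ →+ ℂ :=
    { toFun := fun x => u (Real.exp x) - u 1
      map_zero' := by simp
      map_add' := fun x y => by
        rw [Real.exp_add, key _ _ (Real.exp_pos x) (Real.exp_pos y)]
        ring }
  have hU : Continuous U := by
    change Continuous fun x => u (Real.exp x) - u 1
    refine Continuous.sub ?_ continuous_const
    exact hc.comp_continuous Real.continuous_exp fun x => Real.exp_pos x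
  refine ⟨U 1, fun t ht => ?_⟩
  have h1 : U (Real.log t) = Real.log t • U 1 := by
    have := (U.toRealLinearMap hU).map_smul (Real.log t) 1
    simpa using this
  have h2 : U (Real.log t) = u t - u 1 := by
    change u (Real.exp (Real.log t)) - u 1 = _
    rw [Real.exp_log ht]
  rw [h2] at h1
  rw [eq_add_of_sub_eq h1, Complex.real_smul]
  ring

/-- Solution of the functional equation satisfied by the logarithm of a stable characteristic
function. -/
theorem stable_exponent_form {ψ : ℝ → ℂ} (hc : Continuous ψ)
    {t₁ : ℝ} (h₁ : (ψ t₁).re ≠ 0) {a b : ℕ → ℝ} (ha : ∀ n, 0 < n → 0 < a n)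
    (H : ∀ n : ℕ, 0 < n → ∀ t : ℝ, n * ψ t = ψ (a n * t) + I * b n * t) :
    ∃ α : ℝ, 0 < α ∧
      ((α ≠ 1 ∧ ∃ (m : ℝ) (l : ℂ), ∀ t : ℝ, 0 < t → ψ t = I * m * t - l * ((t ^ α : ℝ) : ℂ)) ∨
      (α = 1 ∧ ∃ m σ k : ℝ, ∀ t : ℝ, 0 < t →
        ψ t = I * m * t - σ * t + I * k * (t * Real.log t : ℝ))) := by
  have hre : ∀ n : ℕ, 0 < n → ScalesBy (fun t => (ψ t).re) n (a n) := fun n hn t => by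
    have := congrArg Complex.re (H n hn t)
    simpa using this
  obtain ⟨α, hα, haα⟩ :=
    exists_rpow_of_scalesBy (h := fun t => (ψ t).re) (by fun_prop) h₁ ha hre
  refine ⟨α, hα, ?_⟩
  have H' : ∀ n : ℕ, 0 < n → ∀ t : ℝ, n * ψ t = ψ ((n : ℝ) ^ α⁻¹ * t) + I * b n * t :=
    fun n hn t => by rw [← haα n hn]; exact H n hn t
  by_cases hα1 : α = 1
  · right
    refine ⟨hα1, ?_⟩
    subst hα1
    simp only [inv_one, Real.rpow_one] at H'
    obtain ⟨D, hD⟩ := exists_eq_add_mul_log (u := fun t => ψ t / t) (d := fun n => - I * b n / n)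
      (hc.continuousOn.div (by fun_prop) fun x hx => by
        exact_mod_cast (ne_of_gt hx : x ≠ 0))
      (fun n hn t ht => by
        have h := H' n hn t
        have hn' : (n : ℂ) ≠ 0 := by exact_mod_cast hn.ne'
        have ht' : (t : ℂ) ≠ 0 := by exact_mod_cast ht.ne'
        rw [← sub_eq_iff_eq_add] at h
        rw [← h]
        push_cast
        field_simp
        ring)
    have hD0 : D.re = 0 := by
      have h := H' 2 two_pos 1
      have h2 := hD 2 two_pos
      have hl2 : 0 < Real.log 2 := Real.log_pos one_lt_two
      have e : D * Real.log 2 = - I * b 2 / 2 := by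
        push_cast at h h2 ⊢
        rw [mul_one] at h
        rw [← sub_eq_iff_eq_add] at h
        rw [← h] at h2
        linear_combination -h2
      have := congrArg Complex.re e
      rw [Complex.re_mul_ofReal] at this
      simpa [hl2.ne'] using this
    refine ⟨(ψ 1).im, -(ψ 1).re, D.im, fun t ht => ?_⟩
    have h := hD t ht
    have ht' : (t : ℂ) ≠ 0 := by exact_mod_cast ht.ne'
    rw [div_eq_iff ht'] at h
    have e1 := Complex.re_add_im (ψ 1)
    have e2 := Complex.re_add_im D
    rw [hD0] at e2
    push_cast at h e1 e2 ⊢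
    linear_combination h - t * e1 - t * Real.log t * e2
  · left
    refine ⟨hα1, ?_⟩
    set κ := α⁻¹ with hκ
    have hκ1 : κ ≠ 1 := by rw [hκ]; simpa using hα1
    have h2κ : (2 : ℝ) - 2 ^ κ ≠ 0 := by
      intro h0
      apply hκ1
      have : (2 : ℝ) ^ κ = 2 ^ (1 : ℝ) := by rw [Real.rpow_one]; linarith
      simpa using congrArg (Real.logb 2) this
    have hb : ∀ n : ℕ, 0 < n → b n = b 2 / (2 - 2 ^ κ) * (n - (n : ℝ) ^ κ) := by
      intro n hn
      have h1 := H' n hn ((2 : ℝ) ^ κ * 1)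
      have h2 := H' 2 two_pos ((n : ℝ) ^ κ * 1)
      have h3 := H' 2 two_pos 1
      have h4 := H' n hn 1
      rw [show (n : ℝ) ^ κ * ((2 : ℝ) ^ κ * 1) = ((2 : ℕ) : ℝ) ^ κ * ((n : ℝ) ^ κ * 1) by
        push_cast; ring] at h1
      have e : (b n : ℂ) * (2 - ((2 ^ κ : ℝ) : ℂ)) = b 2 * (n - (((n : ℝ) ^ κ : ℝ) : ℂ)) := by
        push_cast at h1 h2 h3 h4 ⊢
        apply mul_left_cancel₀ I_ne_zero
        linear_combination h1 - h2 + n * h3 - 2 * h4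
      have e' : b n * (2 - 2 ^ κ) = b 2 * (n - (n : ℝ) ^ κ) := by exact_mod_cast e
      field_simp
      linarith
    set m := b 2 / (2 - 2 ^ κ) with hm
    refine ⟨m, -(ψ 1 - I * m), fun t ht => ?_⟩
    have := eq_rpow_of_homogeneous (χ := fun t => ψ t - I * m * t) (by fun_prop) hα
      (fun n hn t ht => by
        have h := H' n hn t
        rw [hb n hn] at h
        push_cast at h ⊢
        linear_combination h) ht
    simp only [ofReal_one, mul_one] at this
    linear_combination this

open Set Topology in
theorem mellinConvergent_exp_neg_mul {s z : ℂ} (hs : 0 < s.re) (hz : 0 < z.re) :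
    MellinConvergent (fun t : ℝ => cexp (-(z * t))) s := by
  refine mellinConvergent_of_isBigO_rpow_exp (b := 0) hz ?_ ?_ ?_ hs
  · exact (Continuous.continuousOn (by fun_prop)).locallyIntegrableOn measurableSet_Ioi
  · refine Asymptotics.IsBigO.of_bound 1 (Eventually.of_forall fun t => ?_)
    simp [Complex.norm_exp]
  · refine Asymptotics.IsBigO.of_bound 1 ?_
    filter_upwards [self_mem_nhdsWithin] with t ht
    have : 0 < z.re * t := mul_pos hz ht
    simp [Complex.norm_exp]
    linarith

open Set Topology in
theorem differentiableAt_integral_cpow_mul_exp {s z : ℂ} (hs : 0 < s.re) (hz : 0 < z.re) :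
    DifferentiableAt ℂ (fun z : ℂ => mellin (fun t : ℝ => cexp (-(z * t))) s) z := by
  have hz2 : 0 < z.re / 2 := by positivity
  have hmeas : ∀ (s w : ℂ), AEStronglyMeasurable
      (fun t : ℝ => (t : ℂ) ^ (s - 1) • cexp (-(w * t))) (volume.restrict (Ioi 0)) := by
    intro s w
    refine ContinuousOn.aestronglyMeasurable ?_ measurableSet_Ioi
    have hexp : Continuous fun t : ℝ => cexp (-(w * t)) := by fun_prop
    have hpow : ContinuousOn (fun t : ℝ => (t : ℂ) ^ (s - 1)) (Ioi 0) := fun t ht =>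
      (continuousAt_ofReal_cpow_const _ _ (Or.inr (ne_of_gt ht))).continuousWithinAt
    exact hpow.smul hexp.continuousOn
  have hb : Integrable (fun t : ℝ => ‖(t : ℂ) ^ (s + 1 - 1) • cexp (-(((z.re / 2 : ℝ) : ℂ) * t))‖)
      (volume.restrict (Ioi 0)) :=
    (mellinConvergent_exp_neg_mul (s := s + 1) (z := ((z.re / 2 : ℝ) : ℂ))
      (by simp; linarith) (by simpa using hz)).norm
  refine (hasDerivAt_integral_of_dominated_loc_of_deriv_le (μ := volume.restrict (Ioi (0 : ℝ)))
    (F := fun (z : ℂ) (t : ℝ) => (t : ℂ) ^ (s - 1) • cexp (-(z * t)))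
    (F' := fun (z : ℂ) (t : ℝ) => (t : ℂ) ^ (s - 1) * (cexp (-(z * t)) * (-t)))
    (x₀ := z) (s := Metric.ball z (z.re / 2)) (Metric.ball_mem_nhds _ hz2)
    (Eventually.of_forall fun w => hmeas s w) (mellinConvergent_exp_neg_mul hs hz) ?_ ?_ hb
    ?_).2.differentiableAt
  · have := (hmeas s z).mul (f := fun t : ℝ => (t : ℂ) ^ (s - 1) • cexp (-(z * t)))
      (g := fun t : ℝ => -(t : ℂ)) (Continuous.aestronglyMeasurable (by fun_prop))
    refine this.congr (Eventually.of_forall fun t => ?_)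
    simp [mul_assoc]
  · filter_upwards [ae_restrict_mem measurableSet_Ioi] with t ht w hw
    have ht0 : (0 : ℝ) < t := ht
    have hw' : z.re / 2 ≤ w.re := by
      have h1 : |(w - z).re| ≤ ‖w - z‖ := Complex.abs_re_le_norm _
      rw [Metric.mem_ball, dist_eq_norm] at hw
      rw [Complex.sub_re] at h1
      have := (abs_le.1 h1).1
      linarith
    have e : (t : ℂ) ^ (s + 1 - 1) = (t : ℂ) ^ (s - 1) * t := by
      rw [show s + 1 - 1 = (s - 1) + 1 by ring, Complex.cpow_add _ _ (by exact_mod_cast ht0.ne'),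
        Complex.cpow_one]
    rw [e]
    simp only [smul_eq_mul, norm_mul, norm_neg, Complex.norm_exp]
    rw [mul_assoc, mul_comm ‖(t : ℂ)‖]
    have hre : ∀ v : ℂ, (-(v * (t : ℂ))).re = -(v.re * t) := fun v => by simp
    rw [hre, hre, Complex.ofReal_re]
    gcongr
  · refine Eventually.of_forall fun t w _ => ?_
    have h : HasDerivAt (fun z : ℂ => cexp (-(z * t))) (cexp (-(w * t)) * (-t)) w := by
      have h0 : HasDerivAt (fun z : ℂ => -(z * t)) (-t) w := by
        simpa using ((hasDerivAt_id w).mul_const (t : ℂ)).fun_neg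
      exact h0.cexp
    simpa using h.const_mul ((t : ℂ) ^ (s - 1))

open Set Topology in
/-- The Mellin transform of `exp (-z t)` for complex `z` in the right half plane. -/
theorem mellin_exp_neg_mul {s z : ℂ} (hs : 0 < s.re) (hz : 0 < z.re) :
    mellin (fun t : ℝ => cexp (-(z * t))) s = z ^ (-s) * Gamma s := by
  have hopen : IsOpen {z : ℂ | 0 < z.re} := isOpen_lt continuous_const Complex.continuous_re
  have hf : AnalyticOnNhd ℂ (fun z : ℂ => mellin (fun t : ℝ => cexp (-(z * t))) s)
      {z : ℂ | 0 < z.re} := DifferentiableOn.analyticOnNhd (fun w hw =>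
        (differentiableAt_integral_cpow_mul_exp hs hw).differentiableWithinAt) hopen
  have hg : AnalyticOnNhd ℂ (fun z : ℂ => z ^ (-s) * Gamma s) {z : ℂ | 0 < z.re} :=
    DifferentiableOn.analyticOnNhd (fun w hw => (DifferentiableAt.mul_const
      ((differentiableAt_id).cpow_const (Or.inl hw)) _).differentiableWithinAt) hopen
  refine hf.eqOn_of_preconnected_of_frequently_eq hg
    (convex_halfSpace_re_gt 0).isPreconnected (z₀ := 1) (by simp) ?_ hz
  have hreal : ∀ r : ℝ, 0 < r →
      mellin (fun t : ℝ => cexp (-((r : ℂ) * t))) s = (r : ℂ) ^ (-s) * Gamma s := by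
    intro r hr
    have := Complex.integral_cpow_mul_exp_neg_mul_Ioi hs hr
    simp only [mellin, smul_eq_mul]
    rw [this, one_div, Complex.inv_cpow _ _ (by
      rw [Complex.arg_ofReal_of_nonneg hr.le]; exact Real.pi_pos.ne), Complex.cpow_neg]
  have htend : Tendsto (fun n : ℕ => (((1 + 1 / ((n : ℝ) + 1) : ℝ)) : ℂ)) atTop (𝓝[≠] 1) := by
    refine tendsto_nhdsWithin_iff.2 ⟨?_, Eventually.of_forall fun n => ?_⟩
    · have h := (tendsto_one_div_add_atTop_nhds_zero_nat (𝕜 := ℝ)).const_add 1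
      have h2 := (Complex.continuous_ofReal.tendsto _).comp h
      rw [add_zero, Complex.ofReal_one] at h2
      exact h2
    · have : (0 : ℝ) < 1 / ((n : ℝ) + 1) := by positivity
      intro h
      have h' : (1 + 1 / ((n : ℝ) + 1) : ℝ) = 1 := Complex.ofReal_injective h
      linarith
  exact htend.frequently (Eventually.of_forall fun n => hreal _ (by positivity)).frequently

open Set Topology in
theorem mellin_log_mul_exp_neg_mul {s z : ℂ} (hs : 0 < s.re) (hz : 0 < z.re) :
    MellinConvergent (fun t : ℝ => Real.log t • cexp (-(z * t))) s ∧
    HasDerivAt (fun s => z ^ (-s) * Gamma s)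
      (mellin (fun t : ℝ => Real.log t • cexp (-(z * t))) s) s := by
  have h := mellin_hasDerivAt_of_isBigO_rpow (f := fun t : ℝ => cexp (-(z * t)))
    (a := s.re + 1) (b := 0) (s := s)
    ((Continuous.continuousOn (by fun_prop)).locallyIntegrableOn measurableSet_Ioi)
    (Asymptotics.IsBigO.trans (g := fun t : ℝ => Real.exp (-z.re * t))
      (Asymptotics.IsBigO.of_bound 1 (Eventually.of_forall fun t => by simp [Complex.norm_exp]))
      (isLittleO_exp_neg_mul_rpow_atTop hz _).isBigO) (lt_add_one _)
    (Asymptotics.IsBigO.of_bound 1 (by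
      filter_upwards [self_mem_nhdsWithin] with t ht
      have : 0 < z.re * t := mul_pos hz ht
      simp [Complex.norm_exp]
      linarith)) hs
  refine ⟨h.1, h.2.congr_of_eventuallyEq ?_⟩
  have hopen : IsOpen {s : ℂ | 0 < s.re} := isOpen_lt continuous_const Complex.continuous_re
  filter_upwards [hopen.mem_nhds hs] with w hw
  exact (mellin_exp_neg_mul hw hz).symm

open Set in
theorem laplace_rpow {α : ℝ} (hα : -1 < α) {z : ℂ} (hz : 0 < z.re) :
    IntegrableOn (fun t : ℝ => cexp (-(z * t)) * ((t ^ α : ℝ) : ℂ)) (Ioi 0) ∧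
    ∫ t in Ioi (0 : ℝ), cexp (-(z * t)) * ((t ^ α : ℝ) : ℂ) =
      Real.Gamma (α + 1) * z ^ (-((α : ℂ) + 1)) := by
  have hs : 0 < ((α : ℂ) + 1).re := by simp; linarith
  have e : EqOn (fun t : ℝ => (t : ℂ) ^ ((α : ℂ) + 1 - 1) • cexp (-(z * t)))
      (fun t : ℝ => cexp (-(z * t)) * ((t ^ α : ℝ) : ℂ)) (Ioi 0) := fun t ht => by
    have ht0 : (0 : ℝ) < t := ht
    simp only [add_sub_cancel_right, smul_eq_mul]
    rw [Complex.ofReal_cpow ht0.le, mul_comm]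
  refine ⟨(mellinConvergent_exp_neg_mul hs hz).congr_fun e measurableSet_Ioi, ?_⟩
  rw [← setIntegral_congr_fun measurableSet_Ioi e]
  have := mellin_exp_neg_mul hs hz
  rw [mellin] at this
  rw [this, mul_comm, ← Complex.Gamma_ofReal]
  push_cast
  rfl

open Set in
theorem laplace_mul_log {z : ℂ} (hz : 0 < z.re) :
    IntegrableOn (fun t : ℝ => cexp (-(z * t)) * ((t * Real.log t : ℝ) : ℂ)) (Ioi 0) ∧
    ∫ t in Ioi (0 : ℝ), cexp (-(z * t)) * ((t * Real.log t : ℝ) : ℂ) =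
      ((1 - Real.eulerMascheroniConstant : ℝ) - log z) * (z ^ 2)⁻¹ := by
  have h2 : 0 < (2 : ℂ).re := by simp
  have hz0 : z ≠ 0 := by rintro rfl; simp at hz
  have e : EqOn (fun t : ℝ => (t : ℂ) ^ ((2 : ℂ) - 1) • (Real.log t • cexp (-(z * t))))
      (fun t : ℝ => cexp (-(z * t)) * ((t * Real.log t : ℝ) : ℂ)) (Ioi 0) := fun t ht => by
    have : (2 : ℂ) - 1 = 1 := by norm_num
    simp only [this, Complex.cpow_one, smul_eq_mul, Complex.real_smul]
    push_cast
    ring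
  obtain ⟨h1, hd⟩ := mellin_log_mul_exp_neg_mul h2 hz
  refine ⟨IntegrableOn.congr_fun h1 e measurableSet_Ioi, ?_⟩
  rw [← setIntegral_congr_fun measurableSet_Ioi e]
  have hG := Complex.hasDerivAt_Gamma_nat 1
  rw [show ((1 : ℕ) : ℂ) + 1 = 2 by norm_num] at hG
  have hp : HasDerivAt (fun s : ℂ => z ^ (-s)) (z ^ (-2 : ℂ) * log z * (-1)) 2 :=
    (hasDerivAt_neg (2 : ℂ)).const_cpow (Or.inl hz0)
  have := hd.unique (hp.mul hG)
  rw [mellin] at this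
  rw [this]
  have e2 : z ^ (-2 : ℂ) = (z ^ 2)⁻¹ := by
    rw [Complex.cpow_neg]
    norm_cast
  have e3 : Gamma 2 = 1 := by
    have := Complex.Gamma_nat_eq_factorial 1
    rwa [show ((1 : ℕ) : ℂ) + 1 = 2 by norm_num, Nat.factorial_one, Nat.cast_one] at this
  rw [e2, e3]
  simp
  ring

theorem charFun'_eq_charFun (μ : Measure ℝ) (t : ℝ) : charFun' μ t = charFun μ t := by
  rw [charFun_apply_real, charFun']
  congr 1 with x
  ring_nf

open Set in
/-- The Laplace transform of the characteristic function of `ν` is the integral of the resolvent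
kernel. -/
theorem integral_inv_sub_eq_laplace_charFun' (ν : Measure ℝ) [IsProbabilityMeasure ν] {z : ℂ}
    (hz : 0 < z.re) :
    ∫ x : ℝ, (z - I * x)⁻¹ ∂ν = ∫ t in Ioi (0 : ℝ), cexp (-(z * t)) * charFun' ν t := by
  have h1 : ∀ x : ℝ, (z - I * x)⁻¹ = ∫ t in Ioi (0 : ℝ), cexp (-(z * t)) * cexp (I * t * x) := by
    intro x
    have hre : (-(z - I * x)).re < 0 := by simpa using hz
    have h := integral_exp_mul_complex_Ioi hre 0
    have e : ∀ t : ℝ, cexp (-(z * t)) * cexp (I * t * x) = cexp (-(z - I * x) * t) := fun t => by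
      rw [← Complex.exp_add]; ring_nf
    simp_rw [e]
    rw [h, Complex.ofReal_zero, mul_zero, Complex.exp_zero, neg_div_neg_eq, one_div]
  simp_rw [h1]
  rw [integral_integral_swap]
  · refine integral_congr_ae (Eventually.of_forall fun t => ?_)
    simp only [charFun']
    rw [← integral_const_mul]
  · have hi : Integrable (fun t : ℝ => cexp (-(z * t))) (volume.restrict (Ioi 0)) := by
      have := integrableOn_exp_mul_complex_Ioi (a := -z) (by simpa using hz) 0
      simp only [neg_mul] at this
      exact this
    have h2 : Integrable (fun p : ℝ × ℝ => (1 : ℂ) * cexp (-(z * p.2)))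
        (ν.prod (volume.restrict (Ioi 0))) := (integrable_const (1 : ℂ)).mul_prod hi
    refine h2.mono (Continuous.aestronglyMeasurable (by fun_prop))
      (Eventually.of_forall fun p => ?_)
    simp [Function.uncurry, Complex.norm_exp]

/-- A combination of two resolvent kernels with poles near `a` and at `I` is nonnegative with a
double zero at the origin. -/
theorem re_resolvent_combination {ε a : ℝ} (hε : 0 < ε) (ha : a ^ 2 = 1) (x : ℝ) :
    ((⟨2 + ε ^ 2 + ε ^ 4, -2 * a * ε⟩ : ℂ) * ((⟨ε, a⟩ : ℂ) - I * x)⁻¹ +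
      (⟨-ε ^ 3, 2 * a * ε⟩ : ℂ) * (1 - I * x)⁻¹).re =
    ε * (4 + ε ^ 4) * x ^ 2 / ((ε ^ 2 + (a - x) ^ 2) * (1 + x ^ 2)) := by
  have h1 : 0 < ε ^ 2 + (a - x) ^ 2 := by positivity
  have h2 : 0 < 1 + x ^ 2 := by positivity
  simp only [Complex.add_re, Complex.mul_re, Complex.inv_re, Complex.inv_im, Complex.normSq_apply,
    Complex.sub_re, Complex.sub_im, Complex.mul_im, Complex.I_re, Complex.I_im, Complex.ofReal_re,
    Complex.ofReal_im, Complex.one_re, Complex.one_im]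
  rw [show (ε - (0 * x - 1 * 0)) * (ε - (0 * x - 1 * 0)) +
    (a - (0 * 0 + 1 * x)) * (a - (0 * 0 + 1 * x)) = ε ^ 2 + (a - x) ^ 2 by ring,
    show (1 - (0 * x - 1 * 0)) * (1 - (0 * x - 1 * 0)) +
    (0 - (0 * 0 + 1 * x)) * (0 - (0 * 0 + 1 * x)) = 1 + x ^ 2 by ring]
  field_simp
  ring_nf
  have e3 : a ^ 3 = a := by rw [pow_succ, ha, one_mul]
  rw [e3, ha]
  ring

theorem norm_exp_sub_one_le_of_re_nonpos {w : ℂ} (hw : w.re ≤ 0) : ‖cexp w - 1‖ ≤ 2 * ‖w‖ := by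
  by_cases h : ‖w‖ ≤ 1
  · exact Complex.norm_exp_sub_one_le h
  · have h1 : ‖cexp w‖ ≤ 1 := by rw [Complex.norm_exp]; simpa using hw
    have h2 := norm_sub_le (cexp w) 1
    rw [norm_one] at h2
    linarith

open Topology in
theorem tendsto_nat_mul_exp_div_sub_one (w : ℂ) :
    Tendsto (fun n : ℕ => (n : ℂ) * (cexp (w / n) - 1)) atTop (𝓝 w) := by
  have h : HasDerivAt (fun s : ℂ => cexp (w * s)) w 0 := by
    have h0 : HasDerivAt (fun s : ℂ => w * s) w 0 := by
      simpa using (hasDerivAt_id (0 : ℂ)).const_mul w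
    simpa using h0.cexp
  rw [hasDerivAt_iff_tendsto_slope_zero] at h
  have ht : Tendsto (fun n : ℕ => ((n : ℂ))⁻¹) atTop (𝓝[≠] 0) := by
    refine tendsto_nhdsWithin_iff.2 ⟨tendsto_inv_atTop_nhds_zero_nat, ?_⟩
    filter_upwards [eventually_gt_atTop 0] with n hn
    simpa using hn.ne'
  refine (h.comp ht).congr fun n => ?_
  simp [div_eq_mul_inv]

open Set Topology in
theorem laplace_exponent_nonneg {ψ : ℝ → ℂ} (hc : Continuous ψ)
    (hre : ∀ t, (ψ t).re ≤ 0)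
    (h_int : ∀ z : ℂ, 0 < z.re → IntegrableOn (fun t : ℝ => cexp (-(z * t)) * ψ t) (Ioi 0))
    (hν : ∀ n : ℕ, 0 < n → ∃ ν : Measure ℝ, IsProbabilityMeasure ν ∧
      ∀ t, charFun' ν t = cexp (ψ t / n))
    {ε a : ℝ} (hε : 0 < ε) (ha : a ^ 2 = 1) :
    0 ≤ ((⟨2 + ε ^ 2 + ε ^ 4, -2 * a * ε⟩ : ℂ) *
        (∫ t in Ioi (0 : ℝ), cexp (-((⟨ε, a⟩ : ℂ) * t)) * ψ t) +
      (⟨-ε ^ 3, 2 * a * ε⟩ : ℂ) * ∫ t in Ioi (0 : ℝ), cexp (-((1 : ℂ) * t)) * ψ t).re := by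
  set A : ℂ := ⟨2 + ε ^ 2 + ε ^ 4, -2 * a * ε⟩
  set B : ℂ := ⟨-ε ^ 3, 2 * a * ε⟩
  have hlim : ∀ z : ℂ, 0 < z.re → Tendsto (fun n : ℕ => ∫ t in Ioi (0 : ℝ),
      cexp (-(z * t)) * (n * (cexp (ψ t / n) - 1))) atTop
      (𝓝 (∫ t in Ioi (0 : ℝ), cexp (-(z * t)) * ψ t)) := by
    intro z hz
    refine tendsto_integral_of_dominated_convergence
      (fun t => 2 * ‖cexp (-(z * t)) * ψ t‖) (fun n => ?_) ((h_int z hz).norm.const_mul 2)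
      (fun n => Eventually.of_forall fun t => ?_) (Eventually.of_forall fun t => ?_)
    · exact Continuous.aestronglyMeasurable (by fun_prop)
    · rcases Nat.eq_zero_or_pos n with rfl | hn
      · simp
      · have hn' : (0 : ℝ) < n := by exact_mod_cast hn
        have h1 : ‖cexp (ψ t / n) - 1‖ ≤ 2 * ‖ψ t / n‖ :=
          norm_exp_sub_one_le_of_re_nonpos (by
            rw [Complex.div_natCast_re]
            exact div_nonpos_of_nonpos_of_nonneg (hre t) hn'.le)
        rw [norm_div, Complex.norm_natCast] at h1
        rw [norm_mul, norm_mul, norm_mul, Complex.norm_natCast]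
        calc ‖cexp (-(z * t))‖ * (n * ‖cexp (ψ t / n) - 1‖)
            ≤ ‖cexp (-(z * t))‖ * (n * (2 * (‖ψ t‖ / n))) := by gcongr
          _ = 2 * (‖cexp (-(z * t))‖ * ‖ψ t‖) := by field_simp
    · exact (tendsto_nat_mul_exp_div_sub_one (ψ t)).const_mul _
  have hzre : 0 < (⟨ε, a⟩ : ℂ).re := hε
  have h1re : 0 < (1 : ℂ).re := by simp
  have hT := ((hlim _ hzre).const_mul A).add ((hlim 1 h1re).const_mul B)
  refine ge_of_tendsto ((Complex.continuous_re.tendsto _).comp hT) ?_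
  filter_upwards [eventually_gt_atTop 0] with n hn
  obtain ⟨ν, hνp, hνc⟩ := hν n hn
  have hval : ∀ z : ℂ, 0 < z.re → ∫ t in Ioi (0 : ℝ),
      cexp (-(z * t)) * (n * (cexp (ψ t / n) - 1)) = n * (∫ x : ℝ, (z - I * x)⁻¹ ∂ν - z⁻¹) := by
    intro z hz
    have hi : IntegrableOn (fun t : ℝ => cexp (-(z * t))) (Ioi 0) := by
      have := integrableOn_exp_mul_complex_Ioi (a := -z) (by simpa using hz) 0
      simpa only [neg_mul] using this
    have hi2 : IntegrableOn (fun t : ℝ => cexp (-(z * t)) * charFun' ν t) (Ioi 0) := by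
      refine Integrable.mono hi ?_ (Eventually.of_forall fun t => ?_)
      · simp_rw [hνc]
        exact Continuous.aestronglyMeasurable (by fun_prop)
      · rw [norm_mul, charFun'_eq_charFun]
        exact mul_le_of_le_one_right (norm_nonneg _) (norm_charFun_le_one t)
    have e : ∫ t in Ioi (0 : ℝ), cexp (-(z * t)) = z⁻¹ := by
      have := integral_exp_mul_complex_Ioi (a := -z) (by simpa using hz) 0
      simpa [neg_mul] using this
    rw [integral_inv_sub_eq_laplace_charFun' ν hz, ← e, ← integral_sub hi2 hi,
      ← integral_const_mul]
    congr 1 with t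
    rw [hνc]
    ring
  have hbdd : ∀ z : ℂ, 0 < z.re → Integrable (fun x : ℝ => (z - I * x)⁻¹) ν := by
    intro z hz
    have hne : ∀ x : ℝ, z - I * x ≠ 0 := fun x h => by
      have := congrArg Complex.re h
      simp at this
      exact hz.ne' this
    refine Integrable.of_bound (C := z.re⁻¹)
      (Continuous.aestronglyMeasurable (Continuous.inv₀ (by fun_prop) hne))
      (Eventually.of_forall fun x => ?_)
    rw [norm_inv]
    refine inv_anti₀ hz ?_
    have := Complex.re_le_norm (z - I * x)
    simpa using this
  simp only [Function.comp]
  rw [hval _ hzre, hval 1 h1re]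
  have hF0 : (A * (⟨ε, a⟩ : ℂ)⁻¹ + B * 1⁻¹).re = 0 := by
    have := re_resolvent_combination hε ha 0
    rw [Complex.ofReal_zero, mul_zero, sub_zero, sub_zero] at this
    rw [this]
    simp
  have hF : 0 ≤ (A * ∫ x : ℝ, ((⟨ε, a⟩ : ℂ) - I * x)⁻¹ ∂ν + B * ∫ x : ℝ, (1 - I * x)⁻¹ ∂ν).re := by
    rw [← integral_const_mul, ← integral_const_mul,
      ← integral_add ((hbdd _ hzre).const_mul A) ((hbdd 1 h1re).const_mul B)]
    have hi : Integrable (fun x : ℝ => A * ((⟨ε, a⟩ : ℂ) - I * x)⁻¹ + B * (1 - I * x)⁻¹) ν :=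
      ((hbdd _ hzre).const_mul A).add ((hbdd 1 h1re).const_mul B)
    rw [← RCLike.re_eq_complex_re, ← integral_re hi]
    refine integral_nonneg fun x => ?_
    simp only [RCLike.re_eq_complex_re]
    rw [re_resolvent_combination hε ha x]
    positivity
  have key : A * (n * (∫ x : ℝ, ((⟨ε, a⟩ : ℂ) - I * x)⁻¹ ∂ν - (⟨ε, a⟩ : ℂ)⁻¹)) +
      B * (n * (∫ x : ℝ, (1 - I * x)⁻¹ ∂ν - 1⁻¹)) =
      ((n : ℝ) : ℂ) * ((A * ∫ x : ℝ, ((⟨ε, a⟩ : ℂ) - I * x)⁻¹ ∂ν + B * ∫ x : ℝ, (1 - I * x)⁻¹ ∂ν) -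
        (A * (⟨ε, a⟩ : ℂ)⁻¹ + B * 1⁻¹)) := by
    push_cast
    ring
  rw [key, Complex.re_ofReal_mul, Complex.sub_re, hF0, sub_zero]
  positivity

open Set Topology in
/-- Boundary value of the positivity of the Laplace transform of an infinitely divisible exponent
at the points `± I`. -/
theorem re_laplace_boundary_nonneg {ψ : ℝ → ℂ} (hc : Continuous ψ)
    (hre : ∀ t, (ψ t).re ≤ 0)
    (hν : ∀ n : ℕ, 0 < n → ∃ ν : Measure ℝ, IsProbabilityMeasure ν ∧
      ∀ t, charFun' ν t = cexp (ψ t / n))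
    {M : ℂ → ℂ}
    (hM : ∀ z : ℂ, 0 < z.re → IntegrableOn (fun t : ℝ => cexp (-(z * t)) * ψ t) (Ioi 0) ∧
      ∫ t in Ioi (0 : ℝ), cexp (-(z * t)) * ψ t = M z)
    {a : ℝ} (ha : a ^ 2 = 1) (hMc : ContinuousAt M (a * I)) : 0 ≤ (M (a * I)).re := by
  have hε : ∀ᶠ ε : ℝ in 𝓝[>] 0, 0 ≤ (((2 + ε ^ 2 + ε ^ 4 : ℝ) + (-2 * a * ε : ℝ) * I : ℂ) *
      M (ε + a * I) + ((-ε ^ 3 : ℝ) + (2 * a * ε : ℝ) * I : ℂ) * M 1).re := by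
    filter_upwards [self_mem_nhdsWithin] with ε hε
    have h := laplace_exponent_nonneg hc hre (fun z hz => (hM z hz).1) hν hε ha
    rw [(hM _ (by exact hε)).2, (hM 1 (by simp)).2] at h
    simpa only [Complex.mk_eq_add_mul_I] using h
  have hcont : ContinuousAt (fun ε : ℝ => (((2 + ε ^ 2 + ε ^ 4 : ℝ) + (-2 * a * ε : ℝ) * I : ℂ) *
      M (ε + a * I) + ((-ε ^ 3 : ℝ) + (2 * a * ε : ℝ) * I : ℂ) * M 1).re) 0 := by
    have h1 : ContinuousAt (fun ε : ℝ => M (ε + a * I)) 0 :=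
      ContinuousAt.comp (f := fun ε : ℝ => (ε + a * I : ℂ)) (by simpa using hMc) (by fun_prop)
    have hA : Continuous fun ε : ℝ => ((2 + ε ^ 2 + ε ^ 4 : ℝ) + (-2 * a * ε : ℝ) * I : ℂ) := by
      fun_prop
    have hB : Continuous fun ε : ℝ => ((-ε ^ 3 : ℝ) + (2 * a * ε : ℝ) * I : ℂ) := by
      fun_prop
    exact Complex.continuous_re.continuousAt.comp
      ((hA.continuousAt.mul h1).add (hB.continuousAt.mul continuousAt_const))
  have := ge_of_tendsto (hcont.tendsto.mono_left nhdsWithin_le_nhds) hε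
  simpa using this

section CharFunBasics

variable (μ : Measure ℝ)

theorem charFun'_neg (t : ℝ) : charFun' μ (-t) = (starRingEnd ℂ) (charFun' μ t) := by
  rw [charFun'_eq_charFun, charFun'_eq_charFun, charFun_neg]

theorem charFun'_map_affine (p q t : ℝ) :
    charFun' (μ.map fun x => p * x + q) t = charFun' μ (p * t) * cexp (I * q * t) := by
  rw [charFun', integral_map (by fun_prop) (Continuous.aestronglyMeasurable (by fun_prop)), charFun',
    ← integral_mul_const]
  congr 1 with x
  rw [← Complex.exp_add]
  push_cast
  ring_nf

variable [IsProbabilityMeasure μ]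

theorem continuous_charFun' : Continuous (charFun' μ) := by
  rw [funext (charFun'_eq_charFun μ)]
  exact continuous_charFun

theorem charFun'_zero : charFun' μ 0 = 1 := by
  simp [charFun']

theorem norm_charFun'_le_one (t : ℝ) : ‖charFun' μ t‖ ≤ 1 := by
  rw [charFun'_eq_charFun]
  exact norm_charFun_le_one t

theorem integrable_exp_I_mul (t : ℝ) : Integrable (fun x : ℝ => cexp (I * t * x)) μ := by
  refine Integrable.of_bound (C := 1) (Continuous.aestronglyMeasurable (by fun_prop))
    (Eventually.of_forall fun x => ?_)
  rw [Complex.norm_exp]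
  simp

theorem exists_eq_exp_of_norm_charFun'_eq_one (h : ∀ t, ‖charFun' μ t‖ = 1) :
    ∃ m : ℝ, ∀ t : ℝ, charFun' μ t = cexp (I * m * t) := by
  have hae : ∀ t : ℝ, ∀ᵐ x : ℝ ∂μ, charFun' μ t = cexp (I * x * t) := by
    intro t
    have hsq : (starRingEnd ℂ) (charFun' μ t) * charFun' μ t = 1 := by
      rw [← Complex.normSq_eq_conj_mul_self, Complex.normSq_eq_norm_sq, h t]
      simp
    have hi : Integrable (fun x : ℝ => (starRingEnd ℂ) (charFun' μ t) * cexp (I * t * x)) μ :=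
      (integrable_exp_I_mul μ t).const_mul _
    have hnorm : ∀ x : ℝ, ‖(starRingEnd ℂ) (charFun' μ t) * cexp (I * t * x)‖ = 1 := fun x => by
      rw [norm_mul, Complex.norm_exp, RCLike.norm_conj, h t]
      simp
    have hi' : Integrable
        (fun x : ℝ => 1 - ((starRingEnd ℂ) (charFun' μ t) * cexp (I * t * x)).re) μ :=
      (integrable_const 1).sub hi.re
    have h0 : ∫ x : ℝ, (1 - ((starRingEnd ℂ) (charFun' μ t) * cexp (I * t * x)).re) ∂μ = 0 := by
      have hr : ∫ x : ℝ, ((starRingEnd ℂ) (charFun' μ t) * cexp (I * t * x)).re ∂μ = 1 := by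
        have := integral_re hi
        simp only [RCLike.re_eq_complex_re] at this
        rw [this, integral_const_mul]
        change ((starRingEnd ℂ) (charFun' μ t) * charFun' μ t).re = 1
        rw [hsq, Complex.one_re]
      have hire : Integrable
          (fun x : ℝ => ((starRingEnd ℂ) (charFun' μ t) * cexp (I * t * x)).re) μ := hi.re
      rw [integral_sub (integrable_const 1) hire, hr]
      simp
    rw [integral_eq_zero_iff_of_nonneg (fun x => by
      have := Complex.re_le_norm ((starRingEnd ℂ) (charFun' μ t) * cexp (I * t * x))
      rw [hnorm] at this
      simpa using this) hi'] at h0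
    filter_upwards [h0] with x hx
    have hx1 : ((starRingEnd ℂ) (charFun' μ t) * cexp (I * t * x)).re = 1 := by
      have : 1 - ((starRingEnd ℂ) (charFun' μ t) * cexp (I * t * x)).re = 0 := hx
      linarith
    have hx2 : (starRingEnd ℂ) (charFun' μ t) * cexp (I * t * x) = 1 := by
      have h3 := Complex.normSq_apply ((starRingEnd ℂ) (charFun' μ t) * cexp (I * t * x))
      rw [Complex.normSq_eq_norm_sq, hnorm, hx1] at h3
      refine Complex.ext hx1 ?_
      rw [Complex.one_im]
      nlinarith
    calc charFun' μ t
        = charFun' μ t * ((starRingEnd ℂ) (charFun' μ t) * cexp (I * t * x)) := by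
          rw [hx2, mul_one]
      _ = ((starRingEnd ℂ) (charFun' μ t) * charFun' μ t) * cexp (I * t * x) := by ring
      _ = cexp (I * x * t) := by rw [hsq, one_mul]; ring_nf
  obtain ⟨m, hm⟩ := (ae_all_iff.2 fun q : ℚ => hae q).exists
  refine ⟨m, fun t => ?_⟩
  have := (continuous_charFun' μ).ext_on (g := fun t : ℝ => cexp (I * m * t))
    Rat.isDenseEmbedding_coe_real.dense (by fun_prop) (by rintro _ ⟨q, rfl⟩; exact hm q)
  exact congrFun this t

theorem one_sub_re_charFun'_two_mul_le (t : ℝ) :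
    1 - (charFun' μ (2 * t)).re ≤ 4 * (1 - (charFun' μ t).re) := by
  have hre : ∀ s : ℝ, 1 - (charFun' μ s).re = ∫ x : ℝ, (1 - Real.cos (s * x)) ∂μ := by
    intro s
    have hi := integrable_exp_I_mul μ s
    have e : ∀ x : ℝ, RCLike.re (cexp (I * s * x)) = Real.cos (s * x) := fun x => by
      rw [RCLike.re_eq_complex_re, Complex.exp_re]
      simp
    have h1 := integral_re hi
    have h2 := hi.re
    simp only [e] at h1 h2
    rw [integral_sub (integrable_const 1) h2, h1, charFun']
    simp
  have h_int : ∀ s : ℝ, Integrable (fun x : ℝ => 1 - Real.cos (s * x)) μ := fun s => by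
    refine Integrable.of_bound (C := 2) (Continuous.aestronglyMeasurable (by fun_prop))
      (Eventually.of_forall fun x => ?_)
    rw [Real.norm_eq_abs, abs_le]
    constructor <;> linarith [Real.neg_one_le_cos (s * x), Real.cos_le_one (s * x)]
  rw [hre, hre, ← integral_const_mul]
  refine integral_mono (h_int _) ((h_int t).const_mul 4) fun x => ?_
  have := Real.cos_two_mul (t * x)
  simp only
  rw [mul_assoc, this]
  nlinarith [Real.neg_one_le_cos (t * x), Real.cos_le_one (t * x), sq_nonneg (Real.cos (t * x) - 1)]

open Topology in
theorem stable_index_le_two {α : ℝ} {l : ℂ} (hl : 0 < l.re)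
    (h : ∀ t : ℝ, 0 < t → charFun' μ t = cexp (-(l * ((t ^ α : ℝ) : ℂ)))) : α ≤ 2 := by
  by_contra! hα
  have hsmall : ∀ t : ℝ, 0 < t → 1 - (charFun' μ t).re ≤ 2 * (‖l‖ * t ^ α) := by
    intro t ht
    have htα : 0 < t ^ α := Real.rpow_pos_of_pos ht _
    have h1 := norm_exp_sub_one_le_of_re_nonpos (w := -(l * ((t ^ α : ℝ) : ℂ))) (by
      rw [Complex.neg_re, Complex.re_mul_ofReal]
      exact neg_nonpos.2 (by positivity))
    rw [norm_neg, norm_mul, Complex.norm_real, Real.norm_of_nonneg htα.le, ← h t ht] at h1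
    have h2 := (abs_le.1 (Complex.abs_re_le_norm (charFun' μ t - 1))).1
    rw [Complex.sub_re, Complex.one_re] at h2
    linarith
  have hiter : ∀ k : ℕ, 1 - (charFun' μ 1).re ≤ 4 ^ k * (1 - (charFun' μ ((1 / 2) ^ k)).re) := by
    intro k
    induction k with
    | zero => simp
    | succ k ih =>
      have h1 := one_sub_re_charFun'_two_mul_le μ ((1 / 2) ^ (k + 1))
      rw [show (2 : ℝ) * (1 / 2) ^ (k + 1) = (1 / 2) ^ k by rw [pow_succ]; ring] at h1
      calc _ ≤ _ := ih
        _ ≤ 4 ^ k * (4 * (1 - (charFun' μ ((1 / 2) ^ (k + 1))).re)) := by gcongr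
        _ = _ := by rw [pow_succ]; ring
  have hbound : ∀ k : ℕ, 1 - (charFun' μ 1).re ≤ 2 * ‖l‖ * (4 * (1 / 2 : ℝ) ^ α) ^ k := by
    intro k
    have h1 := hsmall ((1 / 2) ^ k) (by positivity)
    calc _ ≤ _ := hiter k
      _ ≤ 4 ^ k * (2 * (‖l‖ * ((1 / 2 : ℝ) ^ k) ^ α)) := by gcongr
      _ = _ := by
        rw [mul_pow, ← Real.rpow_natCast ((1 / 2 : ℝ) ^ α) k, ← Real.rpow_mul (by norm_num),
          mul_comm α, Real.rpow_mul (by norm_num), Real.rpow_natCast]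
        ring
  have hq : 4 * (1 / 2 : ℝ) ^ α < 1 := by
    have : (1 / 2 : ℝ) ^ α < (1 / 2 : ℝ) ^ (2 : ℝ) :=
      Real.rpow_lt_rpow_of_exponent_gt (by norm_num) (by norm_num) hα
    rw [Real.rpow_two] at this
    linarith
  have hlim : Tendsto (fun k : ℕ => 2 * ‖l‖ * (4 * (1 / 2 : ℝ) ^ α) ^ k) atTop (𝓝 0) := by
    simpa using (tendsto_pow_atTop_nhds_zero_of_lt_one (by positivity) hq).const_mul (2 * ‖l‖)
  have h0 : 1 - (charFun' μ 1).re ≤ 0 := ge_of_tendsto hlim (Eventually.of_forall hbound)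
  have h1 : ‖charFun' μ 1‖ < 1 := by
    rw [h 1 one_pos, Complex.norm_exp, Real.exp_lt_one_iff]
    simpa using hl
  linarith [Complex.re_le_norm (charFun' μ 1)]

end CharFunBasics

open Topology in
/-- Nonvanishing and strict contraction of a nondegenerate solution of the stability equation. -/
theorem ne_zero_of_pow_eq {φ : ℝ → ℂ} (hc : Continuous φ) (h0 : φ 0 = 1)
    {t₁ : ℝ} (hle : ∀ t, ‖φ t‖ ≤ 1) (h₁ : ‖φ t₁‖ ≠ 1) {a b : ℝ} (ha : 0 < a)
    (H : ∀ t : ℝ, φ t ^ 2 = φ (a * t) * cexp (I * b * t)) (t : ℝ) : φ t ≠ 0 := by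
  have Hn : ∀ t, ‖φ t‖ ^ 2 = ‖φ (a * t)‖ := fun t => by
    have := congrArg norm (H t)
    rw [norm_pow, norm_mul, Complex.norm_exp] at this
    simpa using this
  have hn0 : Tendsto (fun t => ‖φ t‖) (𝓝 0) (𝓝 1) := by
    simpa [h0] using (hc.norm.tendsto 0)
  have ha1 : 1 < a := by
    by_contra! ha1
    have hpow : ∀ k : ℕ, ‖φ (a ^ k * t₁)‖ ≤ ‖φ t₁‖ := by
      intro k
      induction k with
      | zero => simp
      | succ k ih =>
        have h := Hn (a ^ k * t₁)
        rw [show a * (a ^ k * t₁) = a ^ (k + 1) * t₁ by ring] at h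
        rw [← h]
        nlinarith [hle (a ^ k * t₁), norm_nonneg (φ (a ^ k * t₁))]
    rcases ha1.lt_or_eq with hlt | heq
    · have ht : Tendsto (fun k : ℕ => a ^ k * t₁) atTop (𝓝 0) := by
        simpa using (tendsto_pow_atTop_nhds_zero_of_lt_one ha.le hlt).mul_const t₁
      have := le_of_tendsto (hn0.comp ht) (Eventually.of_forall hpow)
      exact h₁ (le_antisymm (hle _) this)
    · subst heq
      simp only [one_mul] at Hn
      have h01 : ∀ t, ‖φ t‖ = 0 ∨ ‖φ t‖ = 1 := fun t => by
        have h := Hn t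
        have : ‖φ t‖ * (‖φ t‖ - 1) = 0 := by linarith
        rcases mul_eq_zero.1 this with h | h
        · exact Or.inl h
        · exact Or.inr (by linarith)
      have hz : ‖φ t₁‖ = 0 := (h01 t₁).resolve_right h₁
      obtain ⟨s, hs⟩ : (1 / 2 : ℝ) ∈ Set.range fun t => ‖φ t‖ := by
        refine mem_range_of_exists_le_of_exists_ge hc.norm ⟨t₁, ?_⟩ ⟨0, ?_⟩
        · rw [hz]; norm_num
        · rw [h0]; norm_num
      have hs' : ‖φ s‖ = 1 / 2 := hs
      rcases h01 s with h | h <;> rw [hs'] at h <;> norm_num at h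
  intro hzero
  have hpow : ∀ k : ℕ, ‖φ ((a⁻¹) ^ k * t)‖ = 0 := by
    intro k
    induction k with
    | zero => simpa using hzero
    | succ k ih =>
      have h := Hn ((a⁻¹) ^ (k + 1) * t)
      rw [show a * ((a⁻¹) ^ (k + 1) * t) = (a⁻¹) ^ k * t by rw [pow_succ]; field_simp, ih] at h
      exact pow_eq_zero_iff two_ne_zero |>.1 h
  have ht : Tendsto (fun k : ℕ => (a⁻¹) ^ k * t) atTop (𝓝 0) := by
    simpa using (tendsto_pow_atTop_nhds_zero_of_lt_one (inv_nonneg.2 ha.le)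
      (inv_lt_one_of_one_lt₀ ha1)).mul_const t
  have := le_of_tendsto (hn0.comp ht) (Eventually.of_forall fun k => (hpow k).le)
  norm_num at this

/-- A nonvanishing continuous function on the line with value `1` at the origin has a continuous
logarithm vanishing there. -/
theorem exists_continuous_log {φ : ℝ → ℂ} (hc : Continuous φ) (h0 : φ 0 = 1)
    (hne : ∀ t, φ t ≠ 0) : ∃ ψ : ℝ → ℂ, Continuous ψ ∧ ψ 0 = 0 ∧ ∀ t, φ t = cexp (ψ t) := by
  obtain ⟨f, ⟨hf0, hf⟩, -⟩ := isCoveringMapOn_exp.existsUnique_continuousMap_lifts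
    (⟨φ, hc⟩ : C(ℝ, ℂ)) (a₀ := 0) (e₀ := 0) (by simp [h0]) (fun t => by simpa using hne t)
  exact ⟨f, f.continuous, hf0, fun t => (congrFun hf t).symm⟩

/-- A continuous function with exponential `1` that vanishes at a point vanishes identically. -/
theorem eq_zero_of_exp_eq_one {D : ℝ → ℂ} (hc : Continuous D) (h0 : D 0 = 0)
    (h : ∀ t, cexp (D t) = 1) (t : ℝ) : D t = 0 := by
  have := isCoveringMap_exp.eq_of_comp_eq hc (continuous_const (y := (0 : ℂ)))
    (by ext t; simp [h t]) 0 h0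
  exact congrFun this t

theorem conj_stablePsi (α c β m t : ℝ) :
    (starRingEnd ℂ) (stablePsi α c β m t) = stablePsi α c β m (-t) := by
  simp only [stablePsi, map_sub, map_mul, map_one, Complex.conj_I, Complex.conj_ofReal, abs_neg,
    mul_neg, Real.sign_neg, Complex.ofReal_neg, neg_mul]

theorem charFun'_eq_exp_stablePsi_of_pos {μ : Measure ℝ} [IsProbabilityMeasure μ] {α c β m : ℝ}
    (hα : 0 < α) (h : ∀ t : ℝ, 0 < t → charFun' μ t = cexp (stablePsi α c β m t)) (t : ℝ) :
    charFun' μ t = cexp (stablePsi α c β m t) := by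
  rcases lt_trichotomy t 0 with ht | rfl | ht
  · have := h (-t) (by linarith)
    rw [charFun'_neg, ← conj_stablePsi, Complex.exp_conj] at this
    exact (starRingEnd ℂ).injective this
  · simp [charFun'_zero, stablePsi, Real.zero_rpow hα.ne']
  · exact h t ht

theorem natCast_mul_stablePsi {α c β m : ℝ} (hα : 0 < α) {n : ℕ} (hn : 0 < n) :
    ∃ a b : ℝ, 0 < a ∧ ∀ t : ℝ,
      n * stablePsi α c β m t = stablePsi α c β m (a * t) + I * b * t := by
  have hn' : (0 : ℝ) < n := by exact_mod_cast hn
  by_cases hα1 : α = 1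
  · subst hα1
    refine ⟨n, n * |c| * β * (2 / Real.pi) * Real.log n, hn', fun t => ?_⟩
    rcases eq_or_ne t 0 with rfl | ht
    · simp [stablePsi]
    · have e1 : |c * (n * t)| = n * (|c| * |t|) := by
        rw [abs_mul, abs_mul, abs_of_pos hn']; ring
      have e2 : Real.sign (n * t) = Real.sign t := by
        rcases lt_or_gt_of_ne ht with h | h
        · rw [Real.sign_of_neg h, Real.sign_of_neg (mul_neg_of_pos_of_neg hn' h)]
        · rw [Real.sign_of_pos h, Real.sign_of_pos (mul_pos hn' h)]
      have e3 : Real.log |n * t| = Real.log n + Real.log |t| := by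
        rw [abs_mul, abs_of_pos hn', Real.log_mul hn'.ne' (abs_ne_zero.2 ht)]
      have e4 : (t : ℂ) = (|t| : ℝ) * (Real.sign t : ℝ) := by
        rw [← Complex.ofReal_mul]
        congr 1
        rcases lt_or_gt_of_ne ht with h | h
        · rw [Real.sign_of_neg h, abs_of_neg h]; ring
        · rw [Real.sign_of_pos h, abs_of_pos h]; ring
      simp only [stablePsi, if_true, Real.rpow_one]
      rw [e1, e2, e3, abs_mul]
      generalize Real.log (n : ℝ) = L
      push_cast
      linear_combination
        (-(I * n * (|c| : ℝ) * β * (2 / Real.pi) * L) : ℂ) * e4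
  · refine ⟨(n : ℝ) ^ α⁻¹, m * (n - (n : ℝ) ^ α⁻¹), by positivity, fun t => ?_⟩
    have ha : 0 < (n : ℝ) ^ α⁻¹ := by positivity
    have e1 : |c * ((n : ℝ) ^ α⁻¹ * t)| ^ α = n * |c * t| ^ α := by
      rw [show c * ((n : ℝ) ^ α⁻¹ * t) = (n : ℝ) ^ α⁻¹ * (c * t) by ring, abs_mul, abs_of_pos ha,
        Real.mul_rpow ha.le (abs_nonneg _), Real.rpow_inv_rpow hn'.le hα.ne']
    have e2 : Real.sign ((n : ℝ) ^ α⁻¹ * t) = Real.sign t := by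
      rcases lt_trichotomy t 0 with h | rfl | h
      · rw [Real.sign_of_neg h, Real.sign_of_neg (mul_neg_of_pos_of_neg ha h)]
      · simp
      · rw [Real.sign_of_pos h, Real.sign_of_pos (mul_pos ha h)]
    simp only [stablePsi, if_neg hα1]
    rw [e1, e2]
    push_cast
    ring

theorem isStable_of_charFun'_eq {μ : Measure ℝ} {α c β m : ℝ} (hα : 0 < α)
    (h : ∀ t : ℝ, charFun' μ t = cexp (stablePsi α c β m t)) : IsStable μ := by
  intro n hn
  obtain ⟨a, b, ha, hab⟩ := natCast_mul_stablePsi (c := c) (β := β) (m := m) hα hn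
  refine ⟨a, b, ha, fun t => ?_⟩
  rw [h, h, ← Complex.exp_nat_mul, hab, Complex.exp_add]

theorem log_mul_I {a : ℝ} (ha : a ^ 2 = 1) : log (a * I) = (a * (Real.pi / 2) : ℝ) * I := by
  rcases sq_eq_sq_iff_eq_or_eq_neg.1 (ha.trans (one_pow 2).symm) with rfl | rfl
  · simp [Complex.log_I]
  · simp [Complex.log_neg_I]

theorem mul_I_cpow_neg {a : ℝ} (ha : a ^ 2 = 1) (s : ℝ) :
    ((a : ℂ) * I) ^ (-(s : ℂ)) =
      (Real.cos (s * (Real.pi / 2)) : ℝ) - (a * Real.sin (s * (Real.pi / 2)) : ℝ) * I := by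
  have hne : (a : ℂ) * I ≠ 0 := by
    refine mul_ne_zero (fun h => ?_) I_ne_zero
    have : a = 0 := by exact_mod_cast h
    rw [this] at ha
    norm_num at ha
  rw [Complex.cpow_def_of_ne_zero hne, log_mul_I ha,
    show ((a * (Real.pi / 2) : ℝ) : ℂ) * I * (-(s : ℂ)) =
      ((-(a * (s * (Real.pi / 2))) : ℝ) : ℂ) * I by push_cast; ring,
    Complex.exp_mul_I, ← Complex.ofReal_cos, ← Complex.ofReal_sin, Real.cos_neg, Real.sin_neg]
  rcases sq_eq_sq_iff_eq_or_eq_neg.1 (ha.trans (one_pow 2).symm) with rfl | rfl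
  · push_cast; ring_nf
  · rw [neg_one_mul, neg_one_mul, Real.cos_neg, Real.sin_neg]
    push_cast; ring_nf

theorem mul_I_mem_slitPlane {a : ℝ} (ha : a ^ 2 = 1) : (a : ℂ) * I ∈ slitPlane := by
  right
  intro h
  have : a = 0 := by simpa using h
  rw [this] at ha
  norm_num at ha

open Set in
/-- The skewness bound for stable exponents of index different from one. -/
theorem stable_skewness_bound {ψ : ℝ → ℂ} (hc : Continuous ψ) (hre : ∀ t, (ψ t).re ≤ 0)
    (hν : ∀ n : ℕ, 0 < n → ∃ ν : Measure ℝ, IsProbabilityMeasure ν ∧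
      ∀ t, charFun' ν t = cexp (ψ t / n))
    {α m : ℝ} {l : ℂ} (hα : 0 < α)
    (h : ∀ t : ℝ, 0 < t → ψ t = I * m * t - l * ((t ^ α : ℝ) : ℂ)) :
    |l.im * Real.cos (Real.pi * α / 2)| ≤ l.re * Real.sin (Real.pi * α / 2) := by
  have hM : ∀ z : ℂ, 0 < z.re → IntegrableOn (fun t : ℝ => cexp (-(z * t)) * ψ t) (Ioi 0) ∧
      ∫ t in Ioi (0 : ℝ), cexp (-(z * t)) * ψ t =
        I * m * (Real.Gamma (1 + 1) * z ^ (-(((1 : ℝ) : ℂ) + 1))) -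
          l * (Real.Gamma (α + 1) * z ^ (-((α : ℂ) + 1))) := by
    intro z hz
    obtain ⟨i1, v1⟩ := laplace_rpow (α := 1) (by norm_num) hz
    obtain ⟨i2, v2⟩ := laplace_rpow (α := α) (by linarith) hz
    have e : EqOn (fun t : ℝ => I * m * (cexp (-(z * t)) * ((t ^ (1 : ℝ) : ℝ) : ℂ)) -
        l * (cexp (-(z * t)) * ((t ^ α : ℝ) : ℂ)))
        (fun t : ℝ => cexp (-(z * t)) * ψ t) (Ioi 0) := fun t ht => by
      simp only
      rw [h t ht, Real.rpow_one]
      ring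
    have j1 := i1.const_mul (I * m)
    have j2 := i2.const_mul l
    refine ⟨IntegrableOn.congr_fun (j1.sub j2) e measurableSet_Ioi, ?_⟩
    rw [← setIntegral_congr_fun measurableSet_Ioi e, integral_sub j1 j2, integral_const_mul,
      integral_const_mul, v1, v2]
  have key : ∀ a : ℝ, a ^ 2 = 1 →
      0 ≤ l.re * Real.sin (Real.pi * α / 2) - a * (l.im * Real.cos (Real.pi * α / 2)) := by
    intro a ha
    have hsl := mul_I_mem_slitPlane ha
    have hnn := re_laplace_boundary_nonneg hc hre hν hM ha (by
      have hp : ∀ s : ℂ, ContinuousAt (fun z : ℂ => z ^ s) (a * I) := fun s =>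
        continuousAt_cpow_const hsl
      exact (continuousAt_const.mul (continuousAt_const.mul (hp _))).sub
        (continuousAt_const.mul (continuousAt_const.mul (hp _))))
    have p1 := mul_I_cpow_neg ha (1 + 1)
    have p2 := mul_I_cpow_neg ha (α + 1)
    rw [show ((1 : ℝ) + 1) * (Real.pi / 2) = Real.pi by ring, Real.cos_pi, Real.sin_pi] at p1
    rw [show (α + 1) * (Real.pi / 2) = Real.pi * α / 2 + Real.pi / 2 by ring,
      Real.cos_add_pi_div_two, Real.sin_add_pi_div_two] at p2
    rw [Complex.ofReal_add, Complex.ofReal_one] at p1 p2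
    simp only [Complex.ofReal_one] at hnn
    rw [p1, p2] at hnn
    have hG : 0 < Real.Gamma (α + 1) := Real.Gamma_pos_of_pos (by linarith)
    have e : (I * m * (Real.Gamma (1 + 1) * (((-1 : ℝ) : ℂ) - ((a * 0 : ℝ) : ℂ) * I)) -
        l * (Real.Gamma (α + 1) * (((-Real.sin (Real.pi * α / 2) : ℝ) : ℂ) -
          ((a * Real.cos (Real.pi * α / 2) : ℝ) : ℂ) * I))).re =
        Real.Gamma (α + 1) *
          (l.re * Real.sin (Real.pi * α / 2) - a * (l.im * Real.cos (Real.pi * α / 2))) := by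
      simp only [Complex.sub_re, Complex.mul_re, Complex.mul_im, Complex.sub_im, Complex.I_re,
        Complex.I_im, Complex.ofReal_re, Complex.ofReal_im]
      ring
    rw [e] at hnn
    exact nonneg_of_mul_nonneg_right hnn hG
  have k1 := key 1 (by norm_num)
  have k2 := key (-1) (by norm_num)
  rw [abs_le]
  constructor <;> linarith

open Set in
/-- The skewness bound for stable exponents of index one. -/
theorem stable_skewness_bound_one {ψ : ℝ → ℂ} (hc : Continuous ψ) (hre : ∀ t, (ψ t).re ≤ 0)
    (hν : ∀ n : ℕ, 0 < n → ∃ ν : Measure ℝ, IsProbabilityMeasure ν ∧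
      ∀ t, charFun' ν t = cexp (ψ t / n))
    {m σ k : ℝ} (h : ∀ t : ℝ, 0 < t →
      ψ t = I * m * t - σ * t + I * k * (t * Real.log t : ℝ)) :
    |k * (Real.pi / 2)| ≤ σ := by
  have hM : ∀ z : ℂ, 0 < z.re → IntegrableOn (fun t : ℝ => cexp (-(z * t)) * ψ t) (Ioi 0) ∧
      ∫ t in Ioi (0 : ℝ), cexp (-(z * t)) * ψ t =
        (I * m - σ) * (Real.Gamma (1 + 1) * z ^ (-(((1 : ℝ) : ℂ) + 1))) +
          I * k * (((1 - Real.eulerMascheroniConstant : ℝ) - log z) * (z ^ 2)⁻¹) := by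
    intro z hz
    obtain ⟨i1, v1⟩ := laplace_rpow (α := 1) (by norm_num) hz
    obtain ⟨i2, v2⟩ := laplace_mul_log hz
    have e : EqOn (fun t : ℝ => (I * m - σ) * (cexp (-(z * t)) * ((t ^ (1 : ℝ) : ℝ) : ℂ)) +
        I * k * (cexp (-(z * t)) * ((t * Real.log t : ℝ) : ℂ)))
        (fun t : ℝ => cexp (-(z * t)) * ψ t) (Ioi 0) := fun t ht => by
      simp only
      rw [h t ht, Real.rpow_one]
      ring
    have j1 := i1.const_mul (I * m - σ)
    have j2 := i2.const_mul (I * k)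
    refine ⟨IntegrableOn.congr_fun (j1.add j2) e measurableSet_Ioi, ?_⟩
    rw [← setIntegral_congr_fun measurableSet_Ioi e, integral_add j1 j2, integral_const_mul,
      integral_const_mul, v1, v2]
  have key : ∀ a : ℝ, a ^ 2 = 1 → 0 ≤ σ - a * (k * (Real.pi / 2)) := by
    intro a ha
    have hsl := mul_I_mem_slitPlane ha
    have hsq : ((a : ℂ) * I) ^ 2 = -1 := by
      rw [mul_pow, I_sq, ← Complex.ofReal_pow, ha]
      simp
    have hnn := re_laplace_boundary_nonneg hc hre hν hM ha (by
      refine (continuousAt_const.mul (continuousAt_const.mul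
        (continuousAt_cpow_const hsl))).add (continuousAt_const.mul
          ((continuousAt_const.sub (continuousAt_clog hsl)).mul
            (ContinuousAt.inv₀ (by fun_prop) ?_)))
      rw [hsq]
      norm_num)
    have p1 := mul_I_cpow_neg ha (1 + 1)
    rw [show ((1 : ℝ) + 1) * (Real.pi / 2) = Real.pi by ring, Real.cos_pi, Real.sin_pi] at p1
    rw [Complex.ofReal_add, Complex.ofReal_one] at p1
    have hG : Real.Gamma (1 + 1) = 1 := by
      rw [one_add_one_eq_two, Real.Gamma_two]
    simp only [Complex.ofReal_one] at hnn
    rw [p1, hsq, hG, log_mul_I ha] at hnn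
    have e : ((I * m - σ) * (((1 : ℝ) : ℂ) * (((-1 : ℝ) : ℂ) - ((a * 0 : ℝ) : ℂ) * I)) +
        I * k * ((((1 - Real.eulerMascheroniConstant : ℝ) : ℂ) -
          ((a * (Real.pi / 2) : ℝ) : ℂ) * I) * (((-1 : ℝ) : ℂ)))).re =
        σ - a * (k * (Real.pi / 2)) := by
      simp only [Complex.sub_re, Complex.add_re, Complex.mul_re, Complex.mul_im, Complex.sub_im,
        Complex.I_re, Complex.I_im, Complex.ofReal_re, Complex.ofReal_im]
      ring
    rw [show ((-1 : ℂ))⁻¹ = ((-1 : ℝ) : ℂ) by push_cast; norm_num] at hnn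
    rw [e] at hnn
    exact hnn
  have k1 := key 1 (by norm_num)
  have k2 := key (-1) (by norm_num)
  rw [abs_le]
  constructor <;> linarith

/-- Normalization of the parameters of a stable exponent of index different from one. -/
theorem exists_skewness {α σ w : ℝ} (hα : 0 < α) (hα2 : α ≤ 2) (hα1 : α ≠ 1) (hσ : 0 < σ)
    (hw : |w * Real.cos (Real.pi * α / 2)| ≤ σ * Real.sin (Real.pi * α / 2)) :
    ∃ β : ℝ, |β| ≤ 1 ∧ σ * (β * Real.tan (Real.pi * α / 2)) = w := by
  have hπ := Real.pi_pos
  have hcos : Real.cos (Real.pi * α / 2) ≠ 0 := by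
    intro h0
    rw [← Real.cos_pi_div_two] at h0
    have := Real.injOn_cos (Set.mem_Icc.2 ⟨by positivity, by nlinarith⟩)
      (Set.mem_Icc.2 ⟨by positivity, by linarith⟩) h0
    apply hα1
    field_simp at this
    linarith
  set C := Real.cos (Real.pi * α / 2)
  set S := Real.sin (Real.pi * α / 2) with hS
  have hS0 : 0 ≤ S := by
    have : 0 ≤ σ * S := (abs_nonneg _).trans hw
    exact nonneg_of_mul_nonneg_right this hσ
  refine ⟨w * C / (σ * S), ?_, ?_⟩
  · rw [abs_div, abs_of_nonneg (mul_nonneg hσ.le hS0)]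
    exact div_le_one_of_le₀ hw (mul_nonneg hσ.le hS0)
  · rw [Real.tan_eq_sin_div_cos]
    rcases hS0.eq_or_lt with h0 | h0
    · have hw0 : w = 0 := by
        rw [← h0, mul_zero] at hw
        exact (mul_eq_zero.1 (abs_nonpos_iff.1 hw)).resolve_right hcos
      rw [hw0]
      simp
    · change σ * (w * C / (σ * S) * (S / C)) = w
      field_simp

theorem IsStable.exists_stablePsi {μ : Measure ℝ} [IsProbabilityMeasure μ] (h : IsStable μ) :
    ∃ α c β m : ℝ, 0 < α ∧ α ≤ 2 ∧ 0 ≤ c ∧ |β| ≤ 1 ∧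
      ∀ t : ℝ, charFun' μ t = cexp (stablePsi α c β m t) := by
  by_cases hdeg : ∀ t, ‖charFun' μ t‖ = 1
  · obtain ⟨m, hm⟩ := exists_eq_exp_of_norm_charFun'_eq_one μ hdeg
    refine ⟨2, 0, 0, m, two_pos, le_rfl, le_rfl, by simp, fun t => ?_⟩
    rw [hm t]
    simp [stablePsi]
  push Not at hdeg
  obtain ⟨t₀, ht₀⟩ := hdeg
  obtain ⟨t₁, ht₁pos, ht₁⟩ : ∃ t₁ : ℝ, 0 < t₁ ∧ ‖charFun' μ t₁‖ ≠ 1 := by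
    rcases lt_trichotomy t₀ 0 with h0 | rfl | h0
    · refine ⟨-t₀, by linarith, ?_⟩
      rwa [charFun'_neg, RCLike.norm_conj]
    · simp [charFun'_zero] at ht₀
    · exact ⟨t₀, h0, ht₀⟩
  have h' : ∀ n : ℕ, ∃ a b : ℝ, 0 < n → 0 < a ∧ ∀ t : ℝ,
      (charFun' μ t) ^ n = charFun' μ (a * t) * cexp (I * b * t) := fun n => by
    by_cases hn : 0 < n
    · obtain ⟨a, b, hab⟩ := h n hn
      exact ⟨a, b, fun _ => hab⟩
    · exact ⟨0, 0, fun hn' => absurd hn' hn⟩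
  choose a b hab using h'
  have hφc := continuous_charFun' μ
  obtain ⟨ψ, hψc, hψ0, hψ⟩ := exists_continuous_log hφc (charFun'_zero μ)
    (ne_zero_of_pow_eq hφc (charFun'_zero μ) (norm_charFun'_le_one μ) ht₁ (hab 2 two_pos).1
      (hab 2 two_pos).2)
  have hre : ∀ t, (ψ t).re ≤ 0 := fun t => by
    have := norm_charFun'_le_one μ t
    rwa [hψ, Complex.norm_exp, Real.exp_le_one_iff] at this
  have h₁ : (ψ t₁).re ≠ 0 := fun h0 => ht₁ (by rw [hψ, Complex.norm_exp, h0, Real.exp_zero])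
  have H : ∀ n : ℕ, 0 < n → ∀ t : ℝ, n * ψ t = ψ (a n * t) + I * b n * t := by
    intro n hn t
    have := eq_zero_of_exp_eq_one (D := fun t : ℝ => n * ψ t - (ψ (a n * t) + I * b n * t))
      (by fun_prop) (by simp [hψ0]) (fun t => by
        have h2 := (hab n hn).2 t
        rw [hψ, hψ, ← Complex.exp_nat_mul, ← Complex.exp_add] at h2
        rw [Complex.exp_sub, h2, div_self (Complex.exp_ne_zero _)]) t
    exact sub_eq_zero.1 this
  have hν : ∀ n : ℕ, 0 < n → ∃ ν : Measure ℝ, IsProbabilityMeasure ν ∧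
      ∀ t, charFun' ν t = cexp (ψ t / n) := by
    intro n hn
    have ha := (hab n hn).1
    have hn' : (n : ℂ) ≠ 0 := by exact_mod_cast hn.ne'
    refine ⟨μ.map fun x => (a n)⁻¹ * x + -(b n) / (n * a n),
      Measure.isProbabilityMeasure_map (by fun_prop), fun t => ?_⟩
    rw [charFun'_map_affine, hψ, ← Complex.exp_add]
    congr 1
    have h2 := H n hn ((a n)⁻¹ * t)
    rw [mul_inv_cancel_left₀ ha.ne'] at h2
    have ha' : (a n : ℂ) ≠ 0 := by exact_mod_cast ha.ne'
    rw [eq_div_iff hn']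
    push_cast at h2 ⊢
    field_simp at h2 ⊢
    linear_combination h2
  obtain ⟨α, hα, ⟨hα1, m, l, hform⟩ | ⟨hα1, m, σ, k, hform⟩⟩ :=
    stable_exponent_form hψc h₁ (fun n hn => (hab n hn).1) H
  · have hl : 0 < l.re := by
      have h2 := hre t₁
      rw [hform t₁ ht₁pos] at h2 h₁
      have e : (I * m * t₁ - l * ((t₁ ^ α : ℝ) : ℂ)).re = -(l.re * t₁ ^ α) := by
        simp
      rw [e] at h2 h₁
      have hp : 0 < t₁ ^ α := Real.rpow_pos_of_pos ht₁pos _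
      have h3 : 0 < l.re * t₁ ^ α := lt_of_le_of_ne (by linarith) (fun h => h₁ (by linarith))
      exact pos_of_mul_pos_left h3 hp.le
    have hα2 : α ≤ 2 := by
      have := Measure.isProbabilityMeasure_map (μ := μ) (f := fun x : ℝ => 1 * x + -m) (by fun_prop)
      refine stable_index_le_two (μ.map fun x => 1 * x + -m) hl fun t ht => ?_
      rw [charFun'_map_affine, one_mul, hψ, hform t ht, ← Complex.exp_add]
      congr 1
      push_cast
      ring
    have hbound := stable_skewness_bound hψc hre hν hα hform
    obtain ⟨β, hβ, hβw⟩ := exists_skewness (w := -l.im) hα hα2 hα1 hl (by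
      rwa [neg_mul, abs_neg])
    refine ⟨α, l.re ^ α⁻¹, β, m, hα, hα2, by positivity, hβ,
      charFun'_eq_exp_stablePsi_of_pos hα fun t ht => ?_⟩
    rw [hψ, hform t ht]
    congr 1
    have e1 : |l.re ^ α⁻¹ * t| ^ α = l.re * t ^ α := by
      rw [abs_of_pos (by positivity), Real.mul_rpow (by positivity) ht.le,
        Real.rpow_inv_rpow hl.le hα.ne']
    simp only [stablePsi, if_neg hα1, Real.sign_of_pos ht]
    rw [e1]
    have e2 : (l.re : ℂ) * (β * (Real.tan (Real.pi * α / 2) : ℝ)) = -(l.im : ℝ) := by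
      exact_mod_cast hβw
    have e3 := Complex.re_add_im l
    push_cast at e2 ⊢
    linear_combination (((t : ℝ) ^ α : ℝ) : ℂ) * e3 - I * (((t : ℝ) ^ α : ℝ) : ℂ) * e2
  · subst hα1
    have hσ : 0 < σ := by
      have h2 := hre t₁
      rw [hform t₁ ht₁pos] at h2 h₁
      have e : (I * m * t₁ - σ * t₁ + I * k * (t₁ * Real.log t₁ : ℝ)).re = -(σ * t₁) := by
        simp only [Complex.sub_re, Complex.add_re, Complex.mul_re, Complex.mul_im, Complex.I_re,
          Complex.I_im, Complex.ofReal_re, Complex.ofReal_im]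
        ring
      rw [e] at h2 h₁
      have h3 : 0 < σ * t₁ := lt_of_le_of_ne (by linarith) (fun h => h₁ (by linarith))
      exact pos_of_mul_pos_left h3 ht₁pos.le
    have hbound := stable_skewness_bound_one hψc hre hν hform
    have hπ := Real.pi_pos
    refine ⟨1, σ, -(k * (Real.pi / 2)) / σ, m, one_pos, by norm_num, hσ.le, ?_,
      charFun'_eq_exp_stablePsi_of_pos one_pos fun t ht => ?_⟩
    · rw [abs_div, abs_neg, abs_of_pos hσ]
      exact div_le_one_of_le₀ hbound hσ.le
    · rw [hψ, hform t ht]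
      congr 1
      simp only [stablePsi, if_true, Real.sign_of_pos ht, Real.rpow_one]
      rw [abs_of_pos (mul_pos hσ ht), abs_of_pos ht]
      have hσ' : (σ : ℂ) ≠ 0 := by exact_mod_cast hσ.ne'
      have hπ' : (Real.pi : ℂ) ≠ 0 := by exact_mod_cast hπ.ne'
      push_cast
      field_simp
      ring

theorem stmt0 (μ : Measure ℝ) [IsProbabilityMeasure μ] :
    IsStable μ ↔ ∃ α c β m : ℝ, 0 < α ∧ α ≤ 2 ∧ 0 ≤ c ∧ |β| ≤ 1 ∧
      ∀ t : ℝ, charFun' μ t = Complex.exp (stablePsi α c β m t) := by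
  constructor
  · exact fun h => h.exists_stablePsi
  · rintro ⟨α, c, β, m, hα, -, -, -, h⟩
    exact isStable_of_charFun'_eq hα h
end

section
/- (Euler–Cauchy–Saalschütz) Let r < 1 be a real number with r ∉ {0, −1, −2, …}, and let z be a nonzero complex number with Re z ≥ 0. Then the improper integral lim_{T→∞} ∫₀^T x^{r−1} ( e^{−zx} − Σ_{0 ≤ i < −r} (−zx)^i / i! ) dx exists and equals Γ(r)·z^{−r}, where z^{−r} = |z|^{−r} e^{−i r·arg z} is the principal power (arg z ∈ [−π/2, π/2]) and Γ is the real Gamma function, extended from (0,∞) to negative non-integer arguments by the recursion Γ(r+1) = rΓ(r). If Re z > 0 the integral is absolutely convergent. -/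
open MeasureTheory Complex Filter

/-- The remainder of the exponential series after its first `n` terms. -/
noncomputable def expTail (n : ℕ) (w : ℂ) : ℂ :=
  exp w - ∑ i ∈ Finset.range n, w ^ i / (Nat.factorial i : ℂ)

lemma expTail_zero (w : ℂ) : expTail 0 w = exp w := by
  simp [expTail]

lemma expTail_succ_zero (n : ℕ) : expTail (n + 1) 0 = 0 := by
  simp [expTail, Finset.sum_range_succ']

lemma hasDerivAt_expTail_succ (n : ℕ) (w : ℂ) :
    HasDerivAt (expTail (n + 1)) (expTail n w) w := by
  have hsum : HasDerivAt
      (fun w : ℂ => ∑ i ∈ Finset.range (n + 1), w ^ i / (Nat.factorial i : ℂ))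
      (∑ i ∈ Finset.range (n + 1), ((i : ℂ) * w ^ (i - 1)) / (Nat.factorial i : ℂ)) w :=
    HasDerivAt.fun_sum fun i _ => (hasDerivAt_pow i w).div_const _
  have heq : ∑ i ∈ Finset.range (n + 1), ((i : ℂ) * w ^ (i - 1)) / (Nat.factorial i : ℂ)
      = ∑ i ∈ Finset.range n, w ^ i / (Nat.factorial i : ℂ) := by
    rw [Finset.sum_range_succ']
    simp only [Nat.cast_zero, zero_mul, zero_div, add_zero, Nat.add_sub_cancel]
    refine Finset.sum_congr rfl fun i _ => ?_
    rw [Nat.factorial_succ]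
    push_cast
    exact mul_div_mul_left _ _ (Nat.cast_add_one_ne_zero i)
  rw [heq] at hsum
  exact (Complex.hasDerivAt_exp w).sub hsum

lemma hasDerivAt_expTail_succ_neg_mul (n : ℕ) (z : ℂ) (x : ℝ) :
    HasDerivAt (fun x : ℝ => expTail (n + 1) (-z * x)) (-z * expTail n (-z * x)) x := by
  have h1 : HasDerivAt (fun x : ℝ => -z * (x : ℂ)) (-z) x := by
    simpa using (Complex.ofRealCLM.hasDerivAt (x := x)).const_mul (-z)
  exact ((hasDerivAt_expTail_succ n (-z * x)).comp x h1).congr_deriv (mul_comm _ _)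

lemma continuous_expTail_neg_mul (n : ℕ) (z : ℂ) :
    Continuous fun x : ℝ => expTail n (-z * x) := by
  unfold expTail
  fun_prop

lemma norm_expTail_neg_mul_le_of_le (n : ℕ) {z : ℂ} {M x T : ℝ} (hM : ‖z‖ ≤ M)
    (hx : 0 ≤ x) (hxT : x ≤ T) :
    ‖expTail n (-z * x)‖ ≤ M ^ n * Real.exp (M * T) * x ^ n := by
  have hM0 : 0 ≤ M := (norm_nonneg z).trans hM
  have hnorm : ‖-z * (x : ℂ)‖ ≤ M * x := by
    rw [norm_mul, norm_neg, Complex.norm_of_nonneg hx]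
    gcongr
  calc ‖expTail n (-z * x)‖ ≤ ‖-z * (x : ℂ)‖ ^ n * Real.exp ‖-z * (x : ℂ)‖ :=
        norm_exp_sub_sum_le_norm_mul_exp _ n
    _ ≤ (M * x) ^ n * Real.exp (M * T) := by
        gcongr
        exact hnorm.trans (by gcongr)
    _ = _ := by ring

lemma norm_exp_neg_mul_le_one {z : ℂ} {x : ℝ} (hz : 0 ≤ z.re) (hx : 0 ≤ x) :
    ‖exp (-z * x)‖ ≤ 1 := by
  rw [Complex.norm_exp, Real.exp_le_one_iff]
  simpa using mul_nonneg hz hx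

lemma norm_expTail_succ_neg_mul_le_of_one_le (n : ℕ) {z : ℂ} {M x : ℝ} (hM : ‖z‖ ≤ M)
    (hz : 0 ≤ z.re) (hx : 1 ≤ x) :
    ‖expTail (n + 1) (-z * x)‖ ≤ (1 + ∑ i ∈ Finset.range (n + 1), M ^ i) * x ^ n := by
  have hM0 : 0 ≤ M := (norm_nonneg z).trans hM
  have hx0 : 0 ≤ x := zero_le_one.trans hx
  have hterm : ∀ i ∈ Finset.range (n + 1),
      ‖(-z * (x : ℂ)) ^ i / (Nat.factorial i : ℂ)‖ ≤ M ^ i * x ^ n := by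
    intro i hi
    have hin : i ≤ n := Nat.lt_succ_iff.mp (Finset.mem_range.mp hi)
    have hfac : (1 : ℝ) ≤ Nat.factorial i := by exact_mod_cast Nat.factorial_pos i
    rw [norm_div, norm_pow, norm_mul, norm_neg, Complex.norm_of_nonneg hx0, Complex.norm_natCast]
    refine (div_le_self (by positivity) hfac).trans ?_
    rw [mul_pow]
    gcongr
  calc ‖expTail (n + 1) (-z * x)‖
      ≤ ‖exp (-z * x)‖ + ‖∑ i ∈ Finset.range (n + 1), (-z * (x : ℂ)) ^ i / (Nat.factorial i : ℂ)‖ :=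
        norm_sub_le _ _
    _ ≤ x ^ n + ∑ i ∈ Finset.range (n + 1), M ^ i * x ^ n := by
        gcongr
        · exact (norm_exp_neg_mul_le_one hz hx0).trans (one_le_pow₀ hx)
        · exact norm_sum_le_of_le _ hterm
    _ = _ := by rw [← Finset.sum_mul]; ring

lemma exists_norm_expTail_succ_neg_mul_le (n : ℕ) (M : ℝ) :
    ∃ C : ℝ, ∀ z : ℂ, ‖z‖ ≤ M → 0 ≤ z.re → ∀ x : ℝ, 0 < x →
      ‖expTail (n + 1) (-z * x)‖ ≤ C * min (x ^ (n + 1)) (x ^ n) := by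
  refine ⟨max (M ^ (n + 1) * Real.exp (M * 1)) (1 + ∑ i ∈ Finset.range (n + 1), M ^ i),
    fun z hM hz x hx => ?_⟩
  rcases le_total x 1 with h | h
  · rw [min_eq_left (pow_le_pow_of_le_one hx.le h n.le_succ)]
    refine (norm_expTail_neg_mul_le_of_le (n + 1) hM hx.le h).trans ?_
    gcongr
    exact le_max_left _ _
  · rw [min_eq_right (pow_le_pow_right₀ h n.le_succ)]
    refine (norm_expTail_succ_neg_mul_le_of_one_le n hM hz h).trans ?_
    gcongr
    exact le_max_right _ _

lemma aestronglyMeasurable_rpow_mul_expTail (n : ℕ) (r : ℝ) (z : ℂ) (μ : Measure ℝ) :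
    AEStronglyMeasurable (fun x : ℝ => ((x ^ r : ℝ) : ℂ) * expTail n (-z * x)) μ := by
  refine AEStronglyMeasurable.mul ?_ (continuous_expTail_neg_mul n z).aestronglyMeasurable
  exact Measurable.aestronglyMeasurable (by fun_prop)

lemma integrableOn_rpow_mul_min_pow (n : ℕ) {r : ℝ} (hr : -(n + 1 : ℝ) < r) (hr' : r < -n)
    (C : ℝ) :
    IntegrableOn (fun x : ℝ => x ^ (r - 1) * (C * min (x ^ (n + 1)) (x ^ n))) (Set.Ioi 0) := by
  rw [← Set.Ioc_union_Ioi_eq_Ioi zero_le_one]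
  refine IntegrableOn.union ?_ ?_
  · have h : IntegrableOn (fun x : ℝ => C * x ^ (r + n)) (Set.Ioc 0 1) := by
      refine Integrable.const_mul ?_ C
      rw [← IntegrableOn, ← intervalIntegrable_iff_integrableOn_Ioc_of_le zero_le_one]
      exact intervalIntegral.intervalIntegrable_rpow' (by linarith)
    refine h.congr_fun (fun x hx => ?_) measurableSet_Ioc
    have hx0 : 0 < x := hx.1
    simp only
    rw [min_eq_left (pow_le_pow_of_le_one hx0.le hx.2 n.le_succ), mul_left_comm,
      ← Real.rpow_add_natCast hx0.ne']
    push_cast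
    ring_nf
  · have h : IntegrableOn (fun x : ℝ => C * x ^ (r - 1 + n)) (Set.Ioi 1) :=
      (integrableOn_Ioi_rpow_of_lt (by linarith) zero_lt_one).const_mul C
    refine h.congr_fun (fun x hx => ?_) measurableSet_Ioi
    have hx1 : (1 : ℝ) < x := hx
    simp only
    rw [min_eq_right (pow_le_pow_right₀ hx1.le n.le_succ), mul_left_comm,
      ← Real.rpow_add_natCast (by linarith)]

lemma norm_rpow_mul {x : ℝ} (hx : 0 < x) (r : ℝ) (w : ℂ) :
    ‖((x ^ r : ℝ) : ℂ) * w‖ = x ^ r * ‖w‖ := by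
  rw [norm_mul, Complex.norm_of_nonneg (Real.rpow_nonneg hx.le r)]

lemma integrableOn_Ioi_rpow_mul_expTail_succ (n : ℕ) {r : ℝ} (hr : -(n + 1 : ℝ) < r)
    (hr' : r < -n) {z : ℂ} (hz : 0 ≤ z.re) :
    IntegrableOn (fun x : ℝ => ((x ^ (r - 1) : ℝ) : ℂ) * expTail (n + 1) (-z * x))
      (Set.Ioi 0) := by
  obtain ⟨C, hC⟩ := exists_norm_expTail_succ_neg_mul_le n ‖z‖
  refine (integrableOn_rpow_mul_min_pow n hr hr' C).mono'
    (aestronglyMeasurable_rpow_mul_expTail _ _ _ _) ?_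
  filter_upwards [ae_restrict_mem measurableSet_Ioi] with x hx
  rw [norm_rpow_mul hx]
  exact mul_le_mul_of_nonneg_left (hC z le_rfl hz x hx) (Real.rpow_nonneg (le_of_lt hx) _)

lemma intervalIntegrable_rpow_mul_expTail (n : ℕ) {r : ℝ} (hr : -(n : ℝ) < r) (z : ℂ)
    {T : ℝ} (hT : 0 ≤ T) :
    IntervalIntegrable (fun x : ℝ => ((x ^ (r - 1) : ℝ) : ℂ) * expTail n (-z * x))
      volume 0 T := by
  have h : IntervalIntegrable
      (fun x : ℝ => ‖z‖ ^ n * Real.exp (‖z‖ * T) * x ^ (r - 1 + n)) volume 0 T :=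
    (intervalIntegral.intervalIntegrable_rpow' (by linarith)).const_mul _
  rw [intervalIntegrable_iff_integrableOn_Ioc_of_le hT] at h ⊢
  refine h.mono' (aestronglyMeasurable_rpow_mul_expTail _ _ _ _) ?_
  filter_upwards [ae_restrict_mem measurableSet_Ioc] with x hx
  rw [norm_rpow_mul hx.1, Real.rpow_add_natCast hx.1.ne', mul_left_comm]
  exact mul_le_mul_of_nonneg_left (norm_expTail_neg_mul_le_of_le n le_rfl hx.1.le hx.2)
    (Real.rpow_nonneg hx.1.le _)

lemma continuousOn_rpow_mul_expTail_succ (n : ℕ) {r : ℝ} (hr : -(n + 1 : ℝ) < r) (z : ℂ)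
    (T : ℝ) :
    ContinuousOn (fun x : ℝ => ((x ^ r : ℝ) : ℂ) * expTail (n + 1) (-z * x)) (Set.Icc 0 T) := by
  intro x hx
  rcases hx.1.eq_or_lt with rfl | hx0
  · have hzero : ((((0 : ℝ) ^ r : ℝ)) : ℂ) * expTail (n + 1) (-z * (0 : ℝ)) = 0 := by
      simp [expTail_succ_zero]
    simp only [ContinuousWithinAt, hzero]
    have hlim : Tendsto (fun x : ℝ => ‖z‖ ^ (n + 1) * Real.exp (‖z‖ * T) * x ^ (r + (n + 1)))
        (nhdsWithin 0 (Set.Icc 0 T)) (nhds 0) := by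
      have h0 : ContinuousAt (fun x : ℝ => x ^ (r + (n + 1))) 0 :=
        Real.continuousAt_rpow_const _ _ (Or.inr (by linarith))
      have h1 := (h0.tendsto.mono_left (nhdsWithin_le_nhds (s := Set.Icc 0 T))).const_mul
        (‖z‖ ^ (n + 1) * Real.exp (‖z‖ * T))
      simpa [Real.zero_rpow (by linarith : r + (n + 1 : ℝ) ≠ 0)] using h1
    refine squeeze_zero_norm' ?_ hlim
    filter_upwards [self_mem_nhdsWithin] with x hx
    rcases hx.1.eq_or_lt with rfl | hx0
    · rw [hzero, norm_zero]
      positivity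
    · have hpow : x ^ (r + (n + 1)) = x ^ r * x ^ (n + 1) := by
        rw [← Real.rpow_add_natCast hx0.ne']
        push_cast
        rfl
      rw [norm_rpow_mul hx0, hpow, mul_left_comm]
      exact mul_le_mul_of_nonneg_left
        (norm_expTail_neg_mul_le_of_le (n + 1) le_rfl hx.1 hx.2) (Real.rpow_nonneg hx.1 _)
  · refine ContinuousAt.continuousWithinAt ?_
    refine ContinuousAt.mul ?_ (continuous_expTail_neg_mul _ z).continuousAt
    exact Complex.continuous_ofReal.continuousAt.comp
      (Real.continuousAt_rpow_const _ _ (Or.inl hx0.ne'))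

lemma integral_rpow_mul_expTail_succ (n : ℕ) {r : ℝ} (hr : -(n + 1 : ℝ) < r) (hr0 : r ≠ 0)
    (z : ℂ) {T : ℝ} (hT : 0 ≤ T) :
    (r : ℂ) * ∫ x in (0 : ℝ)..T, ((x ^ (r - 1) : ℝ) : ℂ) * expTail (n + 1) (-z * x)
      = ((T ^ r : ℝ) : ℂ) * expTail (n + 1) (-z * T)
        + z * ∫ x in (0 : ℝ)..T, ((x ^ (r + 1 - 1) : ℝ) : ℂ) * expTail n (-z * x) := by
  have hint₁ := (intervalIntegrable_rpow_mul_expTail (n + 1) (r := r)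
    (by push_cast; exact hr) z hT).const_mul (r : ℂ)
  have hint₂ := (intervalIntegrable_rpow_mul_expTail n (r := r + 1)
    (by linarith) z hT).const_mul z
  have hderiv : ∀ x ∈ Set.Ioo 0 T,
      HasDerivAt (fun x : ℝ => ((x ^ r : ℝ) : ℂ) * expTail (n + 1) (-z * x))
        ((r : ℂ) * (((x ^ (r - 1) : ℝ) : ℂ) * expTail (n + 1) (-z * x))
          - z * (((x ^ (r + 1 - 1) : ℝ) : ℂ) * expTail n (-z * x))) x := by
    intro x hx
    refine ((Real.hasDerivAt_rpow_const (p := r) (Or.inl hx.1.ne')).ofReal_comp.mul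
      (hasDerivAt_expTail_succ_neg_mul n z x)).congr_deriv ?_
    rw [add_sub_cancel_right]
    push_cast
    ring
  have hftc := intervalIntegral.integral_eq_sub_of_hasDerivAt_of_le hT
    (continuousOn_rpow_mul_expTail_succ n hr z T) hderiv (hint₁.sub hint₂)
  rw [intervalIntegral.integral_sub hint₁ hint₂, intervalIntegral.integral_const_mul,
    intervalIntegral.integral_const_mul, Real.zero_rpow hr0] at hftc
  simp only [ofReal_zero, zero_mul, sub_zero] at hftc
  exact sub_eq_iff_eq_add.mp hftc

lemma tendsto_rpow_mul_expTail_succ (n : ℕ) {r : ℝ} (hr : r < -n) {z : ℂ} (hz : 0 ≤ z.re) :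
    Tendsto (fun T : ℝ => ((T ^ r : ℝ) : ℂ) * expTail (n + 1) (-z * T)) atTop (nhds 0) := by
  have hlim := (tendsto_rpow_neg_atTop (y := -(r + n)) (by linarith)).const_mul
    (1 + ∑ i ∈ Finset.range (n + 1), ‖z‖ ^ i)
  rw [mul_zero] at hlim
  refine squeeze_zero_norm' ?_ hlim
  filter_upwards [eventually_ge_atTop 1] with T hT
  have hT0 : 0 < T := by linarith
  rw [norm_rpow_mul hT0, neg_neg, Real.rpow_add_natCast hT0.ne', mul_left_comm]
  exact mul_le_mul_of_nonneg_left (norm_expTail_succ_neg_mul_le_of_one_le n le_rfl hz hT)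
    (Real.rpow_nonneg hT0.le _)

lemma Gamma_mul_cpow_neg_recurrence {r : ℝ} (hr : r ≠ 0) {z : ℂ} (hz : z ≠ 0) :
    (r : ℂ) * ((Real.Gamma r : ℂ) * z ^ (-(r : ℂ)))
      = z * ((Real.Gamma (r + 1) : ℂ) * z ^ (-((r + 1 : ℝ) : ℂ))) := by
  have hpow : z ^ (-(r : ℂ)) = z * z ^ (-((r + 1 : ℝ) : ℂ)) := by
    rw [show -(r : ℂ) = 1 + -((r + 1 : ℝ) : ℂ) by push_cast; ring, cpow_add _ _ hz, cpow_one]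
  rw [Real.Gamma_add_one hr, hpow]
  push_cast
  ring

lemma tendsto_integral_expTail_succ_iff (n : ℕ) {r : ℝ} (hr : -(n + 1 : ℝ) < r) (hr' : r < -n)
    {z : ℂ} (hz : z ≠ 0) (hzre : 0 ≤ z.re) :
    Tendsto (fun T : ℝ => ∫ x in (0 : ℝ)..T,
        ((x ^ (r - 1) : ℝ) : ℂ) * expTail (n + 1) (-z * x)) atTop
        (nhds ((Real.Gamma r : ℂ) * z ^ (-(r : ℂ)))) ↔
      Tendsto (fun T : ℝ => ∫ x in (0 : ℝ)..T,
        ((x ^ (r + 1 - 1) : ℝ) : ℂ) * expTail n (-z * x)) atTop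
        (nhds ((Real.Gamma (r + 1) : ℂ) * z ^ (-((r + 1 : ℝ) : ℂ)))) := by
  have hr0 : r ≠ 0 := by
    have : (0 : ℝ) ≤ n := n.cast_nonneg
    linarith
  have hrc : (r : ℂ) ≠ 0 := ofReal_ne_zero.mpr hr0
  have hboundary := tendsto_rpow_mul_expTail_succ n hr' hzre
  have hparts := (eventually_ge_atTop (0 : ℝ)).mono
    fun T hT => integral_rpow_mul_expTail_succ n hr hr0 z hT
  refine (tendsto_const_smul_iff₀ hrc).symm.trans (Iff.trans ?_ (tendsto_const_smul_iff₀ hz))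
  simp only [smul_eq_mul, Gamma_mul_cpow_neg_recurrence hr0 hz]
  rw [tendsto_congr' hparts]
  constructor
  · intro h
    simpa using h.sub hboundary
  · intro h
    simpa using hboundary.add h

lemma integrableOn_rpow_mul_exp_neg_mul {r : ℝ} (hr : 0 < r) {z : ℂ} (hz : 0 < z.re) :
    IntegrableOn (fun x : ℝ => ((x ^ (r - 1) : ℝ) : ℂ) * exp (-z * x)) (Set.Ioi 0) := by
  have h := integrableOn_rpow_mul_exp_neg_mul_rpow (s := r - 1) (by linarith) one_pos hz
  refine h.mono' ?_ ?_
  · simpa only [expTail_zero] using aestronglyMeasurable_rpow_mul_expTail 0 (r - 1) z _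
  · filter_upwards [ae_restrict_mem measurableSet_Ioi] with x hx
    rw [norm_rpow_mul hx, Complex.norm_exp]
    simp

lemma differentiableOn_integral_rpow_mul_exp_neg_mul {r : ℝ} (hr : 0 < r) :
    DifferentiableOn ℂ
      (fun z : ℂ => ∫ x in Set.Ioi (0 : ℝ), ((x ^ (r - 1) : ℝ) : ℂ) * exp (-z * x))
      {z : ℂ | 0 < z.re} := by
  intro z₀ hz₀
  have hz₀' : 0 < z₀.re := hz₀
  refine DifferentiableAt.differentiableWithinAt ?_
  have hbound := integrableOn_rpow_mul_exp_neg_mul_rpow (s := r) (p := 1) (b := z₀.re / 2)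
    (by linarith) one_pos (by linarith)
  have hnhds : {z : ℂ | z₀.re / 2 < z.re} ∈ nhds z₀ :=
    (isOpen_lt continuous_const Complex.continuous_re).mem_nhds
      (show z₀.re / 2 < z₀.re by linarith)
  refine (hasDerivAt_integral_of_dominated_loc_of_deriv_le
    (μ := volume.restrict (Set.Ioi (0 : ℝ)))
    (F := fun z x => ((x ^ (r - 1) : ℝ) : ℂ) * exp (-z * x))
    (F' := fun z x => ((x ^ (r - 1) : ℝ) : ℂ) * (exp (-z * x) * -x)) hnhds
    (Eventually.of_forall fun z => ?_) (integrableOn_rpow_mul_exp_neg_mul hr hz₀') ?_ ?_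
    hbound ?_).2.differentiableAt
  · simpa only [expTail_zero] using aestronglyMeasurable_rpow_mul_expTail 0 (r - 1) z _
  · exact Measurable.aestronglyMeasurable (by fun_prop)
  · filter_upwards [ae_restrict_mem measurableSet_Ioi] with x hx z hz
    have hx0 : 0 < x := hx
    have hz' : z₀.re / 2 < z.re := hz
    rw [norm_rpow_mul hx0, norm_mul, norm_neg, Complex.norm_of_nonneg hx0.le, Complex.norm_exp,
      Real.rpow_one]
    calc x ^ (r - 1) * (Real.exp (-z * x).re * x)
        = x ^ r * Real.exp (-z * x).re := by
          rw [Real.rpow_sub_one hx0.ne']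
          field_simp
      _ ≤ x ^ r * Real.exp (-(z₀.re / 2) * x) := by
          gcongr
          simpa using mul_le_mul_of_nonneg_right hz'.le hx0.le
  · refine Eventually.of_forall fun x z _ => ?_
    have hlin : HasDerivAt (fun z : ℂ => -z * (x : ℂ)) (-x) z := by
      simpa using (hasDerivAt_id z).neg.mul_const (x : ℂ)
    exact hlin.cexp.const_mul _

lemma integral_rpow_mul_exp_neg_mul_of_pos {r a : ℝ} (hr : 0 < r) (ha : 0 < a) :
    ∫ x in Set.Ioi (0 : ℝ), ((x ^ (r - 1) : ℝ) : ℂ) * exp (-(a : ℂ) * x)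
      = (Real.Gamma r : ℂ) * (a : ℂ) ^ (-(r : ℂ)) := by
  have h := congrArg (fun t : ℝ => (t : ℂ)) (Real.integral_rpow_mul_exp_neg_mul_Ioi hr ha)
  rw [← integral_complex_ofReal] at h
  have hpow : (((1 / a) ^ r : ℝ) : ℂ) = (a : ℂ) ^ (-(r : ℂ)) := by
    rw [one_div, Real.inv_rpow ha.le, ← Real.rpow_neg ha.le, Complex.ofReal_cpow ha.le,
      ofReal_neg]
  rw [ofReal_mul, hpow, mul_comm] at h
  rw [← h]
  refine integral_congr_ae (Eventually.of_forall fun x => ?_)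
  simp

lemma integral_rpow_mul_exp_neg_mul {r : ℝ} (hr : 0 < r) {z : ℂ} (hz : 0 < z.re) :
    ∫ x in Set.Ioi (0 : ℝ), ((x ^ (r - 1) : ℝ) : ℂ) * exp (-z * x)
      = (Real.Gamma r : ℂ) * z ^ (-(r : ℂ)) := by
  have hopen : IsOpen {z : ℂ | 0 < z.re} := isOpen_lt continuous_const Complex.continuous_re
  have hrhs : DifferentiableOn ℂ (fun z : ℂ => (Real.Gamma r : ℂ) * z ^ (-(r : ℂ)))
      {z : ℂ | 0 < z.re} := by
    intro w hw
    exact ((differentiableAt_id.cpow_const (Or.inl hw)).const_mul _).differentiableWithinAt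
  have hconn : IsPreconnected {z : ℂ | 0 < z.re} := (convex_halfSpace_re_gt 0).isPreconnected
  refine ((differentiableOn_integral_rpow_mul_exp_neg_mul hr).analyticOnNhd
    hopen).eqOn_of_preconnected_of_frequently_eq (hrhs.analyticOnNhd hopen) hconn
    (z₀ := 1) (by simp) ?_ hz
  have hmap : Tendsto (fun a : ℝ => (a : ℂ)) (nhdsWithin 1 (Set.Ioi 1)) (nhdsWithin 1 {1}ᶜ) := by
    refine tendsto_nhdsWithin_iff.mpr ⟨?_, ?_⟩
    · simpa using (Complex.continuous_ofReal.tendsto 1).mono_left nhdsWithin_le_nhds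
    · filter_upwards [self_mem_nhdsWithin] with a ha
      simpa using (ne_of_gt ha : a ≠ 1)
  refine hmap.frequently (Eventually.frequently ?_)
  filter_upwards [self_mem_nhdsWithin] with a ha
  exact integral_rpow_mul_exp_neg_mul_of_pos hr (zero_lt_one.trans ha)

lemma integral_rpow_mul_expTail_one_of_re_pos {r : ℝ} (hr : -1 < r) (hr' : r < 0) {z : ℂ}
    (hz : 0 < z.re) :
    ∫ x in Set.Ioi (0 : ℝ), ((x ^ (r - 1) : ℝ) : ℂ) * expTail 1 (-z * x)
      = (Real.Gamma r : ℂ) * z ^ (-(r : ℂ)) := by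
  have hz0 : z ≠ 0 := fun h => by simp [h] at hz
  have hexp : Tendsto (fun T : ℝ => ∫ x in (0 : ℝ)..T,
      ((x ^ (r + 1 - 1) : ℝ) : ℂ) * expTail 0 (-z * x)) atTop
      (nhds ((Real.Gamma (r + 1) : ℂ) * z ^ (-((r + 1 : ℝ) : ℂ)))) := by
    simp only [expTail_zero]
    rw [← integral_rpow_mul_exp_neg_mul (by linarith : 0 < r + 1) hz]
    exact intervalIntegral_tendsto_integral_Ioi 0
      (integrableOn_rpow_mul_exp_neg_mul (by linarith) hz) tendsto_id
  have hlim := (tendsto_integral_expTail_succ_iff 0 (by simpa using hr) (by simpa using hr')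
    hz0 hz.le).mpr hexp
  exact tendsto_nhds_unique (intervalIntegral_tendsto_integral_Ioi 0
    (integrableOn_Ioi_rpow_mul_expTail_succ 0 (by simpa using hr) (by simpa using hr') hz.le)
    tendsto_id) hlim

lemma integral_rpow_mul_expTail_one {r : ℝ} (hr : -1 < r) (hr' : r < 0) {z : ℂ}
    (hz : z ≠ 0) (hzre : 0 ≤ z.re) :
    ∫ x in Set.Ioi (0 : ℝ), ((x ^ (r - 1) : ℝ) : ℂ) * expTail 1 (-z * x)
      = (Real.Gamma r : ℂ) * z ^ (-(r : ℂ)) := by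
  have hshift : Tendsto (fun ε : ℝ => z + ε) (nhdsWithin 0 (Set.Ioi 0)) (nhds z) := by
    have h : Continuous fun ε : ℝ => z + (ε : ℂ) := by fun_prop
    simpa using (h.tendsto 0).mono_left (nhdsWithin_le_nhds (s := Set.Ioi 0))
  have hslit : z ∈ slitPlane := by
    rcases hzre.eq_or_lt with h | h
    · exact Or.inr fun him => hz (Complex.ext h.symm him)
    · exact Or.inl h
  have hrhs : Tendsto (fun ε : ℝ => (Real.Gamma r : ℂ) * (z + ε) ^ (-(r : ℂ)))
      (nhdsWithin 0 (Set.Ioi 0)) (nhds ((Real.Gamma r : ℂ) * z ^ (-(r : ℂ)))) :=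
    ((continuousAt_cpow_const hslit).tendsto.comp hshift).const_mul _
  obtain ⟨C, hC⟩ := exists_norm_expTail_succ_neg_mul_le 0 (‖z‖ + 1)
  have hlhs : Tendsto (fun ε : ℝ => ∫ x in Set.Ioi (0 : ℝ),
      ((x ^ (r - 1) : ℝ) : ℂ) * expTail 1 (-(z + ε) * x)) (nhdsWithin 0 (Set.Ioi 0))
      (nhds (∫ x in Set.Ioi (0 : ℝ), ((x ^ (r - 1) : ℝ) : ℂ) * expTail 1 (-z * x))) := by
    refine tendsto_integral_filter_of_dominated_convergence
      (fun x : ℝ => x ^ (r - 1) * (C * min (x ^ (0 + 1)) (x ^ 0)))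
      (Eventually.of_forall fun ε => aestronglyMeasurable_rpow_mul_expTail _ _ _ _) ?_
      (integrableOn_rpow_mul_min_pow 0 (by simpa using hr) (by simpa using hr') C)
      (Eventually.of_forall fun x => ?_)
    · filter_upwards [self_mem_nhdsWithin, hshift.norm.eventually_le_const (lt_add_one ‖z‖)]
        with ε hε hnorm
      filter_upwards [ae_restrict_mem measurableSet_Ioi] with x hx
      rw [norm_rpow_mul hx]
      refine mul_le_mul_of_nonneg_left (hC _ hnorm ?_ x hx) (Real.rpow_nonneg (le_of_lt hx) _)
      simpa using add_nonneg hzre (le_of_lt hε)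
    · have hcont : Continuous (expTail 1) :=
        continuous_iff_continuousAt.mpr fun w => (hasDerivAt_expTail_succ 0 w).continuousAt
      exact ((hcont.tendsto _).comp (hshift.neg.mul_const _)).const_mul _
  refine tendsto_nhds_unique hlhs (hrhs.congr' ?_)
  filter_upwards [self_mem_nhdsWithin] with ε hε
  refine (integral_rpow_mul_expTail_one_of_re_pos hr hr' ?_).symm
  simpa using add_pos_of_nonneg_of_pos hzre hε

lemma tendsto_integral_rpow_mul_expTail {z : ℂ} (hz : z ≠ 0) (hzre : 0 ≤ z.re) (n : ℕ) {r : ℝ}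
    (hr : -(n : ℝ) < r) (hr' : r < -n + 1) :
    Tendsto (fun T : ℝ => ∫ x in (0 : ℝ)..T, ((x ^ (r - 1) : ℝ) : ℂ) * expTail n (-z * x))
      atTop (nhds ((Real.Gamma r : ℂ) * z ^ (-(r : ℂ)))) := by
  induction n generalizing r with
  | zero =>
    simp only [Nat.cast_zero, neg_zero, zero_add] at hr hr'
    have hr₁ : -((0 : ℕ) + 1 : ℝ) < r - 1 := by simpa using hr
    have hr₂ : r - 1 < -((0 : ℕ) : ℝ) := by simpa using hr'
    have hone : Tendsto (fun T : ℝ => ∫ x in (0 : ℝ)..T,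
        ((x ^ (r - 1 - 1) : ℝ) : ℂ) * expTail (0 + 1) (-z * x)) atTop
        (nhds ((Real.Gamma (r - 1) : ℂ) * z ^ (-((r - 1 : ℝ) : ℂ)))) := by
      rw [← integral_rpow_mul_expTail_one (by linarith) (by linarith) hz hzre]
      exact intervalIntegral_tendsto_integral_Ioi 0
        (integrableOn_Ioi_rpow_mul_expTail_succ 0 hr₁ hr₂ hzre) tendsto_id
    simpa only [sub_add_cancel] using
      (tendsto_integral_expTail_succ_iff 0 hr₁ hr₂ hz hzre).mp hone
  | succ n ih =>
    push_cast at hr hr'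
    exact (tendsto_integral_expTail_succ_iff n hr (by linarith) hz hzre).mpr
      (ih (by linarith) (by linarith))

/-- Euler–Cauchy–Saalschütz integral representation of the Gamma function:
for real `r < 1`, not a nonpositive integer, and `z ≠ 0` with `Re z ≥ 0`,
`∫₀^∞ x^{r-1} (e^{-zx} - Σ_{0 ≤ i < -r} (-zx)^i/i!) dx = Γ(r) z^{-r}`
as an improper integral; the integral is absolutely convergent if `Re z > 0`. -/
theorem stmt4 (r : ℝ) (hr : r < 1) (hr' : ∀ n : ℕ, r ≠ -(n : ℝ))
    (z : ℂ) (hz : z ≠ 0) (hzre : 0 ≤ z.re) :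
    Tendsto (fun T : ℝ => ∫ x in Set.Ioc (0 : ℝ) T,
        ((x ^ (r - 1) : ℝ) : ℂ) *
          (Complex.exp (-z * x) -
            ∑ i ∈ Finset.range ⌈-r⌉₊, (-z * x) ^ i / (Nat.factorial i : ℂ)))
      atTop (nhds ((Real.Gamma r : ℂ) * z ^ (-(r : ℂ)))) ∧
    (0 < z.re → IntegrableOn (fun x : ℝ =>
        ((x ^ (r - 1) : ℝ) : ℂ) *
          (Complex.exp (-z * x) -
            ∑ i ∈ Finset.range ⌈-r⌉₊, (-z * x) ^ i / (Nat.factorial i : ℂ)))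
      (Set.Ioi (0 : ℝ))) := by
  have hceil : -r ≤ (⌈-r⌉₊ : ℝ) := Nat.le_ceil _
  have hlow : -(⌈-r⌉₊ : ℝ) < r := lt_of_le_of_ne (by linarith) (hr' _).symm
  have hupp : r < -(⌈-r⌉₊ : ℝ) + 1 := by
    rcases le_total 0 r with h | h
    · rw [Nat.ceil_eq_zero.mpr (by linarith)]
      simpa using hr
    · linarith [Nat.ceil_lt_add_one (by linarith : 0 ≤ -r)]
  constructor
  · refine (tendsto_integral_rpow_mul_expTail hz hzre ⌈-r⌉₊ hlow hupp).congr' ?_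
    filter_upwards [eventually_ge_atTop (0 : ℝ)] with T hT
    rw [intervalIntegral.integral_of_le hT]
    rfl
  · intro hpos
    change IntegrableOn (fun x : ℝ => ((x ^ (r - 1) : ℝ) : ℂ) * expTail ⌈-r⌉₊ (-z * x)) _
    generalize ⌈-r⌉₊ = n at hlow hupp
    cases n with
    | zero =>
      simp only [expTail_zero]
      exact integrableOn_rpow_mul_exp_neg_mul (by simpa using hlow) hpos
    | succ n =>
      push_cast at hlow hupp
      exact integrableOn_Ioi_rpow_mul_expTail_succ n hlow (by linarith) hzre
end
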